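/- arXiv:2311.05603 — 3 statements merged into one kernel-verified Lean document; each statement's English description precedes it below -/
import Mathlib

section
/- Let W ⊂ ℝ^{n+1} be closed with Ω = ℝ^{n+1}∖W and let C be a spanning class for W. If ℓ < ∞, then no curve γ ∈ C is homotopic in Ω to a constant; equivalently, if some γ ∈ C is homotopic in Ω to a point, then ℓ = ∞. -/
open MeasureTheory Set Metric Filter Function
open scoped ENNReal Topology Manifold symmDiff NNReal RealInnerProductSpace

noncomputable section

/-- Euclidean space `ℝ^{n+1}`. -/
abbrev EucSp (n : ℕ) : Type := EuclideanSpace ℝ (Fin (n+1))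

/-- The Lebesgue density of `G` at `x` exists and equals `t`. -/
def DensityEq (n : ℕ) (G : Set (EucSp n)) (x : EucSp n) (t : ℝ≥0∞) : Prop :=
  Tendsto (fun r : ℝ => volume (G ∩ ball x r) / volume (ball x r)) (𝓝[>] 0) (𝓝 t)

/-- `G^{(t)}`, the set of points of Lebesgue density `t` of `G`. -/
def densPts (n : ℕ) (G : Set (EucSp n)) (t : ℝ≥0∞) : Set (EucSp n) :=
  {x | DensityEq n G x t}

/-- The essential boundary `∂ᵉ G = (G^{(0)} ∪ G^{(1)})ᶜ`. -/
def essBdry (n : ℕ) (G : Set (EucSp n)) : Set (EucSp n) :=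
  (densPts n G 0 ∪ densPts n G 1)ᶜ

/-- The measure-theoretic boundary used for `∂*G`; by Federer's theorem it is
`H^n`-equivalent to the reduced boundary for sets of (locally) finite perimeter. -/
def redBdry (n : ℕ) (G : Set (EucSp n)) : Set (EucSp n) := essBdry n G

/-- Relative perimeter `P(G; A)`, via Federer's characterization. -/
def perimIn (n : ℕ) (G A : Set (EucSp n)) : ℝ≥0∞ := μH[n] (A ∩ redBdry n G)

/-- `G` is a set of finite perimeter in `A`. -/
def HasFinitePerimeterIn (n : ℕ) (G A : Set (EucSp n)) : Prop := perimIn n G A < ⊤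

/-- `G` is a set of locally finite perimeter in `A`:
`P(G;F) < ∞` for every `F` compactly contained in `A`. -/
def HasLocallyFinitePerimeterIn (n : ℕ) (G A : Set (EucSp n)) : Prop :=
  ∀ F : Set (EucSp n), IsCompact (closure F) → closure F ⊆ A → μH[n] (F ∩ redBdry n G) < ⊤

/-- `γ` is a smooth embedding of `S¹` into `Ω`. -/
def IsSmoothEmbeddingInto (n : ℕ) (Ω : Set (EucSp n)) (γ : Circle → EucSp n) : Prop :=
  ContMDiff (𝓡 1) 𝓘(ℝ, EucSp n) (⊤ : ℕ∞) γ ∧ Function.Injective γ ∧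
    (∀ p : Circle, Function.Injective (mfderiv (𝓡 1) 𝓘(ℝ, EucSp n) γ p)) ∧
    Set.range γ ⊆ Ω

/-- `γ` and `γ'` are homotopic in `Ω`. -/
def HomotopicIn (n : ℕ) (Ω : Set (EucSp n)) (γ γ' : Circle → EucSp n) : Prop :=
  ∃ H : C(ℝ × Circle, EucSp n), (∀ s, H (0, s) = γ s) ∧ (∀ s, H (1, s) = γ' s) ∧
    ∀ t ∈ Icc (0:ℝ) 1, ∀ s, H (t, s) ∈ Ω

/-- A spanning class for the wire frame `W`: a nonempty family of smooth embeddings of `S¹`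
into `Ω = Wᶜ` which is closed under homotopy in `Ω`. -/
structure SpanningClass (n : ℕ) (W : Set (EucSp n)) where
  curves : Set (Circle → EucSp n)
  nonempty : curves.Nonempty
  isEmb : ∀ γ ∈ curves, IsSmoothEmbeddingInto n Wᶜ γ
  homotopy_closed : ∀ γ ∈ curves, ∀ γ' : Circle → EucSp n,
    IsSmoothEmbeddingInto n Wᶜ γ' → HomotopicIn n Wᶜ γ γ' → γ' ∈ curves

/-- `ℓ`, the infimum in the Harrison–Pugh formulation of the Plateau problem. -/
def plateauInf (n : ℕ) (W : Set (EucSp n)) (C : SpanningClass n W) : ℝ≥0∞ :=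
  sInf { m : ℝ≥0∞ | ∃ S : Set (EucSp n), S ⊆ Wᶜ ∧ closure S ∩ Wᶜ ⊆ S ∧
    (∀ γ ∈ C.curves, (S ∩ Set.range γ).Nonempty) ∧ m = μH[n] S }

/-- `S` essentially disconnects `G` into `{G1, G2}`. -/
def EssDisconnects (n : ℕ) (S G G1 G2 : Set (EucSp n)) : Prop :=
  volume (G ∆ (G1 ∪ G2)) = 0 ∧ 0 < volume G1 ∧ 0 < volume G2 ∧
    μH[n] ((densPts n G 1 ∩ essBdry n G1 ∩ essBdry n G2) \ S) = 0

/-- A member `(γ, Φ, T)` of the tubular spanning class `𝒯(𝒞)`: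
`Φ : S¹ × cl B₁ⁿ → Ω` is a diffeomorphism (onto its image) with `Φ|_{S¹×{0}} = γ`. -/
structure TubTriple (n : ℕ) (W : Set (EucSp n)) (C : SpanningClass n W) where
  γ : Circle → EucSp n
  Φ : Circle × EuclideanSpace ℝ (Fin n) → EucSp n
  mem_curves : γ ∈ C.curves
  smooth : ContMDiff ((𝓡 1).prod 𝓘(ℝ, EuclideanSpace ℝ (Fin n))) 𝓘(ℝ, EucSp n) (⊤ : ℕ∞) Φ
  injOn : InjOn Φ ((univ : Set Circle) ×ˢ closedBall (0 : EuclideanSpace ℝ (Fin n)) 1)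
  immersion : ∀ p ∈ (univ : Set Circle) ×ˢ closedBall (0 : EuclideanSpace ℝ (Fin n)) 1,
    Function.Injective
      (mfderiv ((𝓡 1).prod 𝓘(ℝ, EuclideanSpace ℝ (Fin n))) 𝓘(ℝ, EucSp n) Φ p)
  maps_into : Φ '' ((univ : Set Circle) ×ˢ closedBall (0 : EuclideanSpace ℝ (Fin n)) 1) ⊆ Wᶜ
  restr : ∀ s : Circle, Φ (s, 0) = γ s

/-- The open tube `T = Φ(S¹ × B₁ⁿ)`. -/
def TubTriple.tube {n : ℕ} {W : Set (EucSp n)} {C : SpanningClass n W}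
    (τ : TubTriple n W C) : Set (EucSp n) :=
  τ.Φ '' ((univ : Set Circle) ×ˢ ball (0 : EuclideanSpace ℝ (Fin n)) 1)

/-- The slice `T[s] = Φ({s} × B₁ⁿ)`. -/
def TubTriple.slice {n : ℕ} {W : Set (EucSp n)} {C : SpanningClass n W}
    (τ : TubTriple n W C) (s : Circle) : Set (EucSp n) :=
  τ.Φ '' (({s} : Set Circle) ×ˢ ball (0 : EuclideanSpace ℝ (Fin n)) 1)

/-- Measure-theoretic homotopic spanning (Definition 2.2): a Borel set `S ⊆ Ω` is
`𝒞`-spanning `W` if for every tubular triple and `H¹`-a.e. slice (parametrized through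
`Circle.exp`), `H^n`-a.e. point of the slice lies on the essential boundaries of a
partition `{T1, T2}` of `T` such that `S ∪ T[s]` essentially disconnects `T` into it. -/
def CSpanning (n : ℕ) (W : Set (EucSp n)) (C : SpanningClass n W) (S : Set (EucSp n)) : Prop :=
  ∀ τ : TubTriple n W C,
    ∀ᵐ t ∂(volume : Measure ℝ),
      ∀ᵐ x ∂(μH[n].restrict (τ.slice (Circle.exp t))),
        ∃ T1 T2 : Set (EucSp n), T1 ∪ T2 = τ.tube ∧ Disjoint T1 T2 ∧
          x ∈ essBdry n T1 ∧ x ∈ essBdry n T2 ∧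
          EssDisconnects n (S ∪ τ.slice (Circle.exp t)) τ.tube T1 T2

/-- The class `𝒦_B` of relaxed (possibly collapsed) competitors. -/
def MemKB (n : ℕ) (W : Set (EucSp n)) (K E : Set (EucSp n)) : Prop :=
  K ⊆ Wᶜ ∧ E ⊆ Wᶜ ∧ MeasurableSet K ∧ MeasurableSet E ∧
    HasLocallyFinitePerimeterIn n E Wᶜ ∧
    μH[n] ((Wᶜ ∩ redBdry n E) \ K) = 0

/-- The relaxed (boundary-spanning) energy `𝓕_bd(K,E)`. -/
def Fbd (n : ℕ) (W K E : Set (EucSp n)) : ℝ≥0∞ :=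
  μH[n] (Wᶜ ∩ redBdry n E) + 2 * μH[n] (K \ redBdry n E)

/-- The relaxed (bulk-spanning) energy `𝓕_bk(K,E)`. -/
def Fbk (n : ℕ) (W K E : Set (EucSp n)) : ℝ≥0∞ :=
  μH[n] (Wᶜ ∩ redBdry n E) + 2 * μH[n] (K ∩ densPts n E 0)

/-- `ψ_bd(v)`. -/
def psiBd (n : ℕ) (W : Set (EucSp n)) (C : SpanningClass n W) (v : ℝ≥0∞) : ℝ≥0∞ :=
  sInf { m : ℝ≥0∞ | ∃ E : Set (EucSp n), E ⊆ Wᶜ ∧ MeasurableSet E ∧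
    HasFinitePerimeterIn n E Wᶜ ∧ volume E = v ∧
    CSpanning n W C (Wᶜ ∩ redBdry n E) ∧ m = perimIn n E Wᶜ }

/-- `ψ_bk(v)`. -/
def psiBk (n : ℕ) (W : Set (EucSp n)) (C : SpanningClass n W) (v : ℝ≥0∞) : ℝ≥0∞ :=
  sInf { m : ℝ≥0∞ | ∃ E : Set (EucSp n), E ⊆ Wᶜ ∧ MeasurableSet E ∧
    HasFinitePerimeterIn n E Wᶜ ∧ volume E = v ∧
    CSpanning n W C (densPts n E 1 ∪ (Wᶜ ∩ redBdry n E)) ∧ m = perimIn n E Wᶜ }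

/-- `Ψ_bd(v)`. -/
def PsiBd (n : ℕ) (W : Set (EucSp n)) (C : SpanningClass n W) (v : ℝ≥0∞) : ℝ≥0∞ :=
  sInf { m : ℝ≥0∞ | ∃ K E : Set (EucSp n), MemKB n W K E ∧ volume E = v ∧
    CSpanning n W C K ∧ m = Fbd n W K E }

/-- `Ψ_bk(v)`. -/
def PsiBk (n : ℕ) (W : Set (EucSp n)) (C : SpanningClass n W) (v : ℝ≥0∞) : ℝ≥0∞ :=
  sInf { m : ℝ≥0∞ | ∃ K E : Set (EucSp n), MemKB n W K E ∧ volume E = v ∧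
    CSpanning n W C (densPts n E 1 ∪ K) ∧ m = Fbk n W K E }

/-- `R` is (countably) `H^n`-rectifiable. -/
def HnRectifiable (n : ℕ) (R : Set (EucSp n)) : Prop :=
  ∃ f : ℕ → (EuclideanSpace ℝ (Fin n) → EucSp n),
    (∀ i, ∃ L : ℝ≥0, LipschitzWith L (f i)) ∧ μH[n] (R \ ⋃ i, Set.range (f i)) = 0

/-- `R` is locally `H^n`-rectifiable in `Ω`: locally `H^n`-finite and rectifiable. -/
def LocHnRectifiableIn (n : ℕ) (Ω R : Set (EucSp n)) : Prop :=
  MeasurableSet R ∧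
    (∀ F : Set (EucSp n), IsCompact (closure F) → closure F ⊆ Ω → μH[n] (R ∩ F) < ⊤) ∧
    HnRectifiable n R

/-- `P` is purely `H^n`-unrectifiable. -/
def PurelyHnUnrectifiable (n : ℕ) (P : Set (EucSp n)) : Prop :=
  ∀ f : EuclideanSpace ℝ (Fin n) → EucSp n, (∃ L : ℝ≥0, LipschitzWith L f) →
    μH[n] (P ∩ Set.range f) = 0

/-- `R` is (a representative of) the `H^n`-rectifiable part `𝓡(S)` of `S`. -/
def IsRectPartOf (n : ℕ) (R S : Set (EucSp n)) : Prop :=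
  R ⊆ S ∧ MeasurableSet R ∧ HnRectifiable n R ∧ PurelyHnUnrectifiable n (S \ R)

/-- `P` is a Lebesgue partition of `U`. -/
def IsLebPartition (n : ℕ) {ι : Type} (U : Set (EucSp n)) (P : ι → Set (EucSp n)) : Prop :=
  Countable ι ∧ (∀ i, MeasurableSet (P i)) ∧ (∀ i, P i ⊆ U) ∧
    Pairwise (Function.onFun Disjoint P) ∧ volume (U \ ⋃ i, P i) = 0

/-- The partition `P` of `U` is induced by `S`: `U^{(1)} ∩ ∂ᵉ P i` is `H^n`-contained
in `S` for every `i`. -/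
def PartitionInducedBy (n : ℕ) {ι : Type} (U : Set (EucSp n)) (P : ι → Set (EucSp n))
    (S : Set (EucSp n)) : Prop :=
  ∀ i, μH[n] ((densPts n U 1 ∩ essBdry n (P i)) \ S) = 0

/-- `P` is an essential partition of `U` induced by `S`. -/
def IsEssPartition (n : ℕ) {ι : Type} (U : Set (EucSp n)) (P : ι → Set (EucSp n))
    (S : Set (EucSp n)) : Prop :=
  IsLebPartition n U P ∧ PartitionInducedBy n U P S ∧
    ∀ i, ∀ G1 G2 : Set (EucSp n), ¬ EssDisconnects n S (P i) G1 G2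

/-- Weak-star convergence of Radon measures, tested against `C_c` functions. -/
def WeakStarTendsto (n : ℕ) (μs : ℕ → Measure (EucSp n)) (ν : Measure (EucSp n)) : Prop :=
  ∀ f : C(EucSp n, ℝ), HasCompactSupport ⇑f →
    Tendsto (fun j => ∫ x, f x ∂(μs j)) atTop (𝓝 (∫ x, f x ∂ν))

/-- `D` has Lipschitz (topological) boundary: near each of its points, `∂D` is the
graph of a Lipschitz function over some hyperplane. -/
def HasLipschitzBoundary (n : ℕ) (D : Set (EucSp n)) : Prop :=
  ∀ x ∈ frontier D, ∃ (v : EucSp n) (g : EucSp n → ℝ) (L : ℝ≥0) (r : ℝ),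
    ‖v‖ = 1 ∧ 0 < r ∧ LipschitzWith L g ∧
    frontier D ∩ ball x r =
      {z : EucSp n | z ∈ ball x r ∧ ⟪z, v⟫ = g (z - ⟪z, v⟫ • v)}

/-- The Lipschitz graph map `y ↦ y + F(y) v` over the hyperplane `v^⊥`. -/
def graphMap (n : ℕ) (v : EucSp n) (F : EucSp n → ℝ) : EucSp n → EucSp n :=
  fun y => y + F y • v

end

attribute [local instance] finrank_real_complex_fact'

theorem aux_no_emb_zero (γ : Circle → EucSp 0) (hc : Continuous γ) (hi : Function.Injective γ) :
    False := by
  let f : Circle → ℝ := fun z => γ z 0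
  have hf : Continuous f := by
    have : Continuous fun z => (EuclideanSpace.proj (𝕜 := ℝ) (0 : Fin (0+1))) (γ z) :=
      (EuclideanSpace.proj (𝕜 := ℝ) (0 : Fin (0+1))).continuous.comp hc
    exact this
  have hg : Continuous fun z => f z - f (-z) := hf.sub (hf.comp continuous_neg)
  obtain ⟨z, hz⟩ : ∃ z, f z - f (-z) = 0 := by
    have h1 : f (-1) - f (-(-1)) = -(f 1 - f (-1)) := by rw [neg_neg]; ring
    rcases le_total 0 (f 1 - f (-1)) with h | h
    · exact mem_range_of_exists_le_of_exists_ge hg ⟨-1, by rw [h1]; linarith⟩ ⟨1, h⟩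
    · exact mem_range_of_exists_le_of_exists_ge hg ⟨1, h⟩ ⟨-1, by rw [h1]; linarith⟩
  have h2 : γ z = γ (-z) := by
    ext i
    fin_cases i
    exact sub_eq_zero.1 hz
  have h3 := congrArg (fun w : Circle => (w : ℂ)) (hi h2)
  have h4 : ((-z : Circle) : ℂ) = -(z : ℂ) := rfl
  simp only [h4] at h3
  have h5 : (z : ℂ) = 0 := self_eq_neg.1 h3
  exact Circle.coe_ne_zero z h5

theorem aux_inj_clm (m : ℕ) : ∃ L : ℂ →L[ℝ] EucSp (m+1), Function.Injective L := by
  refine ⟨Complex.reCLM.smulRight (EuclideanSpace.single 0 1) +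
    Complex.imCLM.smulRight (EuclideanSpace.single 1 1), ?_⟩
  intro z w h
  have h0 := congrArg (fun v : EucSp (m+1) => v 0) h
  have h1 := congrArg (fun v : EucSp (m+1) => v 1) h
  apply Complex.ext
  · simpa using h0
  · simpa using h1

theorem aux_emb {n : ℕ} (L : ℂ →L[ℝ] EucSp n) (hL : Function.Injective L) (q : EucSp n)
    (U : Set (EucSp n)) (hU : ∀ z : Circle, q + L z ∈ U) :
    IsSmoothEmbeddingInto n U (fun z : Circle => q + L z) := by
  have hA : ContMDiff (𝓡 1) 𝓘(ℝ, ℂ) (⊤ : ℕ∞) (fun z : Circle => (z : ℂ)) :=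
    contMDiff_coe_sphere (E := ℂ) (n := 1)
  have hB : ContDiff ℝ (⊤ : ℕ∞) (fun w : ℂ => q + L w) := contDiff_const.add L.contDiff
  refine ⟨hB.contMDiff.comp hA, ?_, ?_, ?_⟩
  · intro z w h
    exact Subtype.ext (hL (add_left_cancel h))
  · intro p
    have hd : HasMFDerivAt 𝓘(ℝ, ℂ) 𝓘(ℝ, EucSp n) (fun w : ℂ => q + L w) (p : ℂ) L :=
      (L.hasFDerivAt.const_add q).hasMFDerivAt
    have hd' : HasMFDerivAt (𝓡 1) 𝓘(ℝ, ℂ) (fun z : Circle => (z : ℂ)) p _ :=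
      ((hA p).mdifferentiableAt (by simp)).hasMFDerivAt
    have := (hd.comp p hd').mfderiv
    have e : (fun w : ℂ => q + L w) ∘ (fun z : Circle => (z : ℂ)) =
      fun z : Circle => q + L z := rfl
    rw [e] at this
    rw [this]
    have hinj : Function.Injective (mfderiv (𝓡 1) 𝓘(ℝ, ℂ) (fun z : Circle => (z : ℂ)) p) := by
      have := injective_mvfderiv_subtypeVal_sphere (E := ℂ) (n := 1) p
      exact this
    exact hL.comp hinj
  · rintro _ ⟨z, rfl⟩
    exact hU z

/-- **Remark 3.4 (Consequences of `ℓ < ∞`).** If `𝒞` is a spanning class for `W` such that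
`ℓ < ∞`, then no curve `γ ∈ 𝒞` is homotopic in `Ω` to a constant. -/
theorem no_curve_homotopic_to_point_of_plateauInf_lt_top
    (n : ℕ) (W : Set (EucSp n)) (hW : IsClosed W) (C : SpanningClass n W)
    (hℓ : plateauInf n W C < ⊤) :
    ∀ γ ∈ C.curves, ¬ ∃ p : EucSp n, HomotopicIn n Wᶜ γ (fun _ => p) := by
  rintro γ hγ ⟨p, H, H0, H1, HΩ⟩
  replace H1 : ∀ s : Circle, H (1, s) = p := H1
  obtain _ | m := n
  · exact aux_no_emb_zero γ (C.isEmb γ hγ).1.continuous (C.isEmb γ hγ).2.1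
  obtain ⟨_, ⟨S, hSW, hScl, hSpan, rfl⟩, hlt⟩ := sInf_lt_iff.1 hℓ
  have hp : p ∈ Wᶜ := by
    rw [← H1 1]; exact HΩ 1 (by simp) 1
  obtain ⟨r, hr, hball⟩ := Metric.isOpen_iff.1 hW.isOpen_compl p hp
  have hdim : dimH S ≤ ((m+1 : ℕ) : ℝ≥0) := by
    apply dimH_le_of_hausdorffMeasure_ne_top
    simpa using hlt.ne
  have hdense : Dense Sᶜ := by
    apply dense_compl_of_dimH_lt_finrank
    refine hdim.trans_lt ?_
    rw [finrank_euclideanSpace_fin]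
    exact_mod_cast Nat.lt_succ_self (m+1)
  obtain ⟨q, hqS, hqp⟩ := hdense.exists_mem_open isOpen_ball ⟨p, mem_ball_self hr⟩
  have hqcl : q ∉ closure S := fun h => hqS (hScl ⟨h, hball hqp⟩)
  have hopen : IsOpen (ball p r ∩ (closure S)ᶜ) := isOpen_ball.inter isClosed_closure.isOpen_compl
  obtain ⟨δ, hδ, hsub⟩ := Metric.isOpen_iff.1 hopen q ⟨hqp, hqcl⟩
  obtain ⟨L₀, hL₀⟩ := aux_inj_clm m
  have hpos : 0 < ‖L₀‖ + 1 := by positivity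
  set ρ : ℝ := δ / (‖L₀‖ + 1) with hρ
  have hρ0 : 0 < ρ := by positivity
  let L : ℂ →L[ℝ] EucSp (m+1) := ρ • L₀
  have hL : Function.Injective L := by
    intro z w h
    exact hL₀ (smul_right_injective _ hρ0.ne' h)
  have hmem : ∀ z : Circle, q + L z ∈ ball q δ := by
    intro z
    rw [mem_ball, dist_eq_norm, add_sub_cancel_left]
    have h1 : ‖L₀ (z : ℂ)‖ ≤ ‖L₀‖ := by
      have h2 := L₀.le_opNorm (z : ℂ)
      have h3 : ‖(z : ℂ)‖ = 1 := Circle.norm_coe z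
      rwa [h3, mul_one] at h2
    calc ‖L (z : ℂ)‖ = ρ * ‖L₀ (z : ℂ)‖ := by
          change ‖ρ • L₀ (z : ℂ)‖ = _
          rw [norm_smul, Real.norm_of_nonneg hρ0.le]
      _ < ρ * (‖L₀‖ + 1) := by gcongr; linarith
      _ = δ := by rw [hρ]; field_simp
  have hemb : IsSmoothEmbeddingInto (m+1) Wᶜ (fun z : Circle => q + L z) :=
    aux_emb L hL q _ fun z => hball (hsub (hmem z)).1
  have hcurve := C.homotopy_closed γ hγ _ hemb (by
    have hc : Continuous fun x : ℝ × Circle =>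
        H (max 0 (min (2 * x.1) 1), x.2) +
          (max 0 (2 * x.1 - 1)) • (q + L (x.2 : ℂ) - p) := by
      have : Continuous fun x : ℝ × Circle => (x.2 : ℂ) :=
        continuous_subtype_val.comp continuous_snd
      have := L.continuous.comp this
      have h3 : Continuous fun x : ℝ × Circle => (max 0 (min (2 * x.1) 1), x.2) := by fun_prop
      have h4 := H.continuous.comp h3
      simp only [Function.comp_def] at this h4
      fun_prop
    refine ⟨⟨_, hc⟩, ?_, ?_, ?_⟩
    · intro s
      simp [H0]
    · intro s
      have h2 : (2:ℝ) - 1 = 1 := by norm_num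
      simp [H1, h2]
    · rintro t ⟨ht0, ht1⟩ s
      simp only [ContinuousMap.coe_mk]
      rcases le_total t (1/2) with h | h
      · rw [max_eq_left (by linarith : 2 * t - 1 ≤ 0), zero_smul, add_zero]
        exact HΩ _ ⟨le_max_left _ _, by simp⟩ s
      · rw [min_eq_right (by linarith : 1 ≤ 2 * t), max_eq_right zero_le_one, H1,
          max_eq_right (by linarith : 0 ≤ 2 * t - 1)]
        exact hball ((convex_ball p r).add_smul_sub_mem (mem_ball_self hr)
          (hsub (hmem s)).1 ⟨by linarith, by linarith⟩))
  obtain ⟨x, hxS, z, rfl⟩ := hSpan _ hcurve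
  exact (hsub (hmem z)).2 (subset_closure hxS)
end

section
/- Let W ⊂ ℝ^{n+1} be closed with Ω = ℝ^{n+1}∖W, let δ > 0, and let {𝒟_k}_{k≥0} be open sets of finite perimeter in Ω whose closures are pairwise disjoint, such that: (i) dist(𝒟_k, cl 𝒟_0 ∪ … ∪ cl 𝒟_{k−1}) > 0 for each k ≥ 1; (ii) |𝒟_k| ≤ δ 2^{−k−2} for each k; (iii) |B_s(z) ∩ 𝒟_k| < 2^{−k−3} |B_s(z)| for every k ≥ 1, every z ∈ cl 𝒟_0 ∪ … ∪ cl 𝒟_{k−1}, and every s > 0; and (iv) ∑_k P(𝒟_k; Ω) < ∞. Then F := ⋃_{k≥0} 𝒟_k is a set of finite perimeter in Ω with |F| ≤ δ/2, P(F;Ω) ≤ ∑_k P(𝒟_k;Ω), and Ω ∩ ∂*F is H^n-equivalent to ⋃_k ∂*𝒟_k. -/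
open MeasureTheory Set Metric Filter Function
open scoped ENNReal Topology Manifold symmDiff NNReal RealInnerProductSpace

/-! ### A topological lemma on the line -/

theorem hpF_right {P : Set ℝ} {A : Set ℝ} {s0 δ q : ℝ} (hA : A ⊆ P)
    (hK : ∀ y ∈ frontier P, |y - s0| < δ → y ∈ A) (hs0 : s0 ∈ P) (hq : q ∉ P)
    (hlt : s0 < q) (hqδ : q < s0 + δ) :
    ∃ s ∈ P, ∃ η > 0, ∀ t ∈ Ioo 0 η, s + t ∉ P := by
  set S := P ∩ Icc s0 q with hS
  have hne : S.Nonempty := ⟨s0, hs0, le_refl _, hlt.le⟩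
  have hbd : BddAbove S := ⟨q, fun y hy => hy.2.2⟩
  set s := sSup S with hs
  have hs1 : s0 ≤ s := le_csSup hbd ⟨hs0, le_refl _, hlt.le⟩
  have hs2 : s ≤ q := csSup_le hne fun y hy => hy.2.2
  have hcl : s ∈ closure P := closure_mono inter_subset_left (csSup_mem_closure hne hbd)
  have hsq : s < q := by
    rcases hs2.lt_or_eq with h | h
    · exact h
    · exfalso
      apply hq
      apply hA
      apply hK
      · rw [frontier_eq_closure_inter_closure]
        exact ⟨h ▸ hcl, subset_closure hq⟩
      · rw [abs_lt]; constructor <;> linarith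
  have hout : ∀ t ∈ Ioo 0 (q - s), s + t ∉ P := by
    intro t ht hP
    have := le_csSup hbd (show s + t ∈ S from ⟨hP, by linarith [ht.1], by linarith [ht.2]⟩)
    linarith [ht.1]
  refine ⟨s, ?_, q - s, by linarith, hout⟩
  apply hA
  apply hK
  · rw [frontier_eq_closure_inter_closure]
    refine ⟨hcl, ?_⟩
    rw [Metric.mem_closure_iff]
    intro ε hε
    refine ⟨s + min (ε/2) ((q-s)/2), hout _ ⟨?_, ?_⟩, ?_⟩
    · apply lt_min <;> linarith
    · apply (min_le_right _ _).trans_lt; linarith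
    · rw [Real.dist_eq, abs_lt]
      have h1 : 0 < min (ε/2) ((q-s)/2) := by apply lt_min <;> linarith
      have h2 := min_le_left (ε/2) ((q-s)/2)
      constructor <;> linarith
  · rw [abs_lt]; constructor <;> linarith

theorem hpF_side {P : Set ℝ} {A : Set ℝ} {s0 δ : ℝ} (hδ : 0 < δ) (hA : A ⊆ P)
    (hs : s0 ∈ frontier P)
    (hK : ∀ y ∈ frontier P, |y - s0| < δ → y ∈ A) :
    ∃ s ∈ P, ∃ η > 0, (∀ t ∈ Ioo 0 η, s + t ∉ P) ∨ (∀ t ∈ Ioo 0 η, s - t ∉ P) := by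
  have hs0 : s0 ∈ P := hA (hK s0 hs (by simpa using hδ))
  rw [frontier_eq_closure_inter_closure] at hs
  obtain ⟨q, hq, hd⟩ := Metric.mem_closure_iff.1 hs.2 δ hδ
  rw [Real.dist_eq, abs_lt] at hd
  rcases lt_trichotomy s0 q with h | h | h
  · obtain ⟨s, h1, η, h2, h3⟩ := hpF_right hA hK hs0 hq h (by linarith)
    exact ⟨s, h1, η, h2, Or.inl h3⟩
  · exact absurd (h ▸ hs0) hq
  · obtain ⟨s, h1, η, h2, h3⟩ := hpF_right (P := Neg.neg ⁻¹' P) (A := Neg.neg ⁻¹' A) (s0 := -s0)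
      (δ := δ) (q := -q) (preimage_mono hA) (by
        intro y hy hyd
        apply hK
        · have := (Homeomorph.neg ℝ).preimage_frontier P
          have h4 : y ∈ (Homeomorph.neg ℝ) ⁻¹' frontier P := by rw [this]; exact hy
          exact h4
        · rw [abs_lt] at *; constructor <;> linarith) (by simpa using hs0) (by simpa using hq)
        (by linarith) (by linarith)
    refine ⟨-s, h1, η, h2, Or.inr ?_⟩
    intro t ht
    have := h3 t ht
    rw [mem_preimage, neg_add] at this
    rwa [sub_eq_add_neg]

theorem hpF_baire {P : Set ℝ} {A B : ℕ → Set ℝ} (hA : ∀ m, IsClosed (A m))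
    (hB : ∀ m, IsClosed (B m)) (hP : P = ⋃ m, A m) (hQ : Pᶜ = ⋃ m, B m) (hne : P.Nonempty)
    (hne' : P ≠ univ) :
    ∃ s, ∃ η > 0, (∀ t ∈ Ioo 0 η, (s + t ∈ P ↔ s ∉ P)) ∨ (∀ t ∈ Ioo 0 η, (s - t ∈ P ↔ s ∉ P)) := by
  have hfr : (frontier P).Nonempty := nonempty_frontier_iff.2 ⟨hne, hne'⟩
  have hcl : IsClosed (frontier P) := isClosed_frontier
  have : Nonempty (frontier P) := hfr.to_subtype
  have : CompleteSpace (frontier P) := hcl.completeSpace_coe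
  let C : ℕ ⊕ ℕ → Set (frontier P) := Sum.elim (fun m => Subtype.val ⁻¹' A m)
    (fun m => Subtype.val ⁻¹' B m)
  obtain ⟨i, ⟨x, hx⟩⟩ := nonempty_interior_of_iUnion_of_closed (f := C) (by
    rintro (m | m)
    · exact (hA m).preimage continuous_subtype_val
    · exact (hB m).preimage continuous_subtype_val) (by
    rw [eq_univ_iff_forall]
    intro x
    rw [mem_iUnion]
    by_cases h : (x : ℝ) ∈ P
    · obtain ⟨m, hm⟩ := mem_iUnion.1 (hP.subset h)
      exact ⟨Sum.inl m, hm⟩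
    · obtain ⟨m, hm⟩ := mem_iUnion.1 (hQ.subset h)
      exact ⟨Sum.inr m, hm⟩)
  rw [mem_interior_iff_mem_nhds, Metric.mem_nhds_iff] at hx
  obtain ⟨δ, hδ, hb⟩ := hx
  rcases i with m | m
  · obtain ⟨s, h1, η, h2, h3⟩ := hpF_side (P := P) (A := A m) (s0 := x) hδ
      (by rw [hP]; exact subset_iUnion _ _) x.2 (fun y hy hyd => hb (show (⟨y, hy⟩ : frontier P) ∈ ball x δ from hyd))
    refine ⟨s, η, h2, h3.imp ?_ ?_⟩ <;>
    · intro h t ht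
      simp [h1, h t ht]
  · obtain ⟨s, h1, η, h2, h3⟩ := hpF_side (P := Pᶜ) (A := B m) (s0 := x) hδ
      (by rw [hQ]; exact subset_iUnion _ _) (by rw [frontier_compl]; exact x.2)
      (fun y hy hyd => hb (show (⟨y, by rwa [frontier_compl] at hy⟩ : frontier P) ∈ ball x δ from hyd))
    refine ⟨s, η, h2, h3.imp ?_ ?_⟩ <;>
    · intro h t ht
      have := h t ht
      simp only [mem_compl_iff, not_not] at this h1
      simp [h1, this]

/-- Version on an interval. -/
theorem hpF_line {X : Type*} [TopologicalSpace X] {g : ℝ → X} (hg : Continuous g) {ℓ : ℝ} (hℓ : 0 ≤ ℓ)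
    {I O : Set X} {A B : ℕ → Set X} (hA : ∀ m, IsClosed (A m)) (hB : ∀ m, IsClosed (B m))
    (hI : I ⊆ ⋃ m, A m) (hO : O ⊆ ⋃ m, B m) (hAO : ∀ m, Disjoint (A m) O)
    (hBI : ∀ m, Disjoint (B m) I) (hdisjInOut : Disjoint I O)
    (hcov : ∀ s ∈ Icc 0 ℓ, g s ∈ I ∪ O) (h0 : ¬ (g 0 ∈ I ↔ g ℓ ∈ I)) :
    ∃ s, ∃ η > 0, (g s ∈ I ∧ ∀ t ∈ Ioo 0 η, g (s + t) ∈ O) ∨ (g s ∈ I ∧ ∀ t ∈ Ioo 0 η, g (s - t) ∈ O)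
     ∨ (g s ∈ O ∧ ∀ t ∈ Ioo 0 η, g (s + t) ∈ I) ∨ (g s ∈ O ∧ ∀ t ∈ Ioo 0 η, g (s - t) ∈ I) := by
  let c : ℝ → ℝ := fun s => max 0 (min s ℓ)
  have hc : Continuous c := by fun_prop
  have hcm : ∀ s, c s ∈ Icc 0 ℓ := fun s => ⟨le_max_left _ _, max_le hℓ (min_le_right _ _)⟩
  have hcid : ∀ s ∈ Icc 0 ℓ, c s = s := fun s hs => by simp [c, min_eq_left hs.2, max_eq_right hs.1]
  have hnot : ∀ x, x ∈ I → x ∉ O := fun x h h' => hdisjInOut.le_bot ⟨h, h'⟩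
  have hgc : ∀ s, g (c s) ∉ I ↔ g (c s) ∈ O := fun s =>
    ⟨fun h => (hcov _ (hcm s)).resolve_left h, fun h h' => hnot _ h' h⟩
  have hcompl : ∀ s, g (c s) ∉ I → g (c s) ∈ O := fun s h => (hgc s).1 h
  obtain ⟨s, η, hη, h⟩ := hpF_baire (P := (g ∘ c) ⁻¹' I) (A := fun m => (g ∘ c) ⁻¹' A m)
    (B := fun m => (g ∘ c) ⁻¹' B m) (fun m => (hA m).preimage (hg.comp hc))
    (fun m => (hB m).preimage (hg.comp hc)) (by
      ext s
      simp only [mem_preimage, mem_iUnion, Function.comp]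
      constructor
      · intro h; simpa using hI h
      · rintro ⟨m, hm⟩
        by_contra h
        exact (hAO m).le_bot ⟨hm, hcompl s h⟩) (by
      ext s
      simp only [mem_preimage, mem_iUnion, Function.comp, mem_compl_iff]
      constructor
      · intro h; simpa using hO (hcompl s h)
      · rintro ⟨m, hm⟩ h
        exact (hBI m).le_bot ⟨hm, h⟩) (by
      have e0 := hcid 0 ⟨le_refl _, hℓ⟩
      have e1 := hcid ℓ ⟨hℓ, le_refl _⟩
      by_cases h : g 0 ∈ I
      · exact ⟨0, by simpa [e0] using h⟩
      · exact ⟨ℓ, by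
          simp only [mem_preimage, Function.comp, e1]
          tauto⟩) (by
      intro h
      have e0 := hcid 0 ⟨le_refl _, hℓ⟩
      have e1 := hcid ℓ ⟨hℓ, le_refl _⟩
      rw [eq_univ_iff_forall] at h
      have h1 := h 0
      have h2 := h ℓ
      simp only [mem_preimage, Function.comp, e0, e1] at h1 h2
      tauto)
  simp only [mem_preimage, Function.comp] at h
  rcases h with h | h
  · have hs0 : 0 ≤ s := by
      by_contra! hs
      have h1 := h (min (η/2) (-s)) ⟨lt_min (by linarith) (by linarith), (min_le_left _ _).trans_lt (by linarith)⟩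
      have h2 : c (s + min (η/2) (-s)) = c s := by
        have := min_le_right (η/2) (-s)
        simp only [c]
        rw [max_eq_left ((min_le_left _ _).trans (by linarith)), max_eq_left ((min_le_left _ _).trans (by linarith))]
      rw [h2] at h1
      tauto
    have hs1 : s < ℓ := by
      by_contra! hs
      have h1 := h (η/2) ⟨by linarith, by linarith⟩
      have h2 : c (s + η/2) = c s := by
        simp only [c]
        rw [min_eq_right (by linarith), min_eq_right hs]
      rw [h2] at h1
      tauto
    have es := hcid s ⟨hs0, hs1.le⟩
    have key : ∀ t ∈ Ioo 0 (min η (ℓ - s)), (g (s + t) ∈ I ↔ g s ∉ I) ∧ (g (s+t) ∉ I → g (s+t) ∈ O) := by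
      intro t ht
      have h1 := h t ⟨ht.1, ht.2.trans_le (min_le_left _ _)⟩
      have h2 := ht.2.trans_le (min_le_right _ _)
      have h3 := hcompl (s+t)
      rw [hcid (s + t) ⟨by linarith [ht.1], by linarith⟩] at h1 h3
      rw [es] at h1
      exact ⟨h1, h3⟩
    refine ⟨s, min η (ℓ - s), lt_min hη (by linarith), ?_⟩
    have h5 := hcompl s
    rw [es] at h5
    by_cases hI : g s ∈ I
    · left
      exact ⟨hI, fun t ht => (key t ht).2 (by rw [(key t ht).1]; simpa using hI)⟩
    · right; right; left
      exact ⟨h5 hI, fun t ht => (key t ht).1.2 hI⟩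
  · have hs0 : 0 < s := by
      by_contra! hs
      have h1 := h (η/2) ⟨by linarith, by linarith⟩
      have h2 : c (s - η/2) = c s := by
        simp only [c]
        rw [max_eq_left ((min_le_left _ _).trans (by linarith)), max_eq_left ((min_le_left _ _).trans (by linarith))]
      rw [h2] at h1
      tauto
    have hs1 : s ≤ ℓ := by
      by_contra! hs
      have h1 := h (min (η/2) (s-ℓ)) ⟨lt_min (by linarith) (by linarith), (min_le_left _ _).trans_lt (by linarith)⟩
      have h2 : c (s - min (η/2) (s-ℓ)) = c s := by
        have := min_le_right (η/2) (s-ℓ)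
        simp only [c]
        rw [min_eq_right (by linarith), min_eq_right hs.le]
      rw [h2] at h1
      tauto
    have es := hcid s ⟨hs0.le, hs1⟩
    have key : ∀ t ∈ Ioo 0 (min η s), (g (s - t) ∈ I ↔ g s ∉ I) ∧ (g (s-t) ∉ I → g (s-t) ∈ O) := by
      intro t ht
      have h1 := h t ⟨ht.1, ht.2.trans_le (min_le_left _ _)⟩
      have h2 := ht.2.trans_le (min_le_right _ _)
      have h3 := hcompl (s-t)
      rw [hcid (s - t) ⟨by linarith [ht.1], by linarith [ht.1]⟩] at h1 h3
      rw [es] at h1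
      exact ⟨h1, h3⟩
    refine ⟨s, min η s, lt_min hη (by linarith), ?_⟩
    have h5 := hcompl s
    rw [es] at h5
    by_cases hI : g s ∈ I
    · right; left
      exact ⟨hI, fun t ht => (key t ht).2 (by rw [(key t ht).1]; simpa using hI)⟩
    · right; right; right
      exact ⟨h5 hI, fun t ht => (key t ht).1.2 hI⟩

/-! ### Lebesgue density basics -/

theorem hpF_ball (n : ℕ) (x : EucSp n) {r : ℝ} (hr : 0 ≤ r) :
    volume (ball x r) = ENNReal.ofReal (r ^ (n+1)) * volume (ball (0 : EucSp n) 1) := by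
  have := Measure.addHaar_ball (volume : Measure (EucSp n)) x hr
  simpa using this

theorem hpF_ball_ne_zero (n : ℕ) (x : EucSp n) {r : ℝ} (hr : 0 < r) :
    volume (ball x r) ≠ 0 := (measure_ball_pos _ _ hr).ne'

theorem hpF_ball_ne_top (n : ℕ) (x : EucSp n) (r : ℝ) :
    volume (ball x r) ≠ ⊤ := measure_ball_lt_top.ne

theorem hpF_inter_closedBall (n : ℕ) (G : Set (EucSp n)) (x : EucSp n) (r : ℝ) :
    volume (G ∩ closedBall x r) = volume (G ∩ ball x r) := by
  apply le_antisymm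
  · have h : G ∩ closedBall x r ⊆ (G ∩ ball x r) ∪ sphere x r := by
      rintro y ⟨h1, h2⟩
      rw [← ball_union_sphere] at h2
      rcases h2 with h2 | h2
      · exact Or.inl ⟨h1, h2⟩
      · exact Or.inr h2
    calc _ ≤ _ := measure_mono h
      _ ≤ _ := measure_union_le _ _
      _ = _ := by rw [Measure.addHaar_sphere]; simp
  · exact measure_mono (inter_subset_inter_right _ ball_subset_closedBall)

theorem hpF_dens_compl (n : ℕ) {E : Set (EucSp n)} (hE : MeasurableSet E) :
    densPts n E 1 = densPts n Eᶜ 0 := by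
  have key : ∀ (F : Set (EucSp n)), MeasurableSet F → ∀ x : EucSp n, ∀ r : ℝ, 0 < r →
      volume (Fᶜ ∩ ball x r) / volume (ball x r) = 1 - volume (F ∩ ball x r) / volume (ball x r) := by
    intro F hF x r hr
    have h0 := hpF_ball_ne_zero n x hr
    have h1 := hpF_ball_ne_top n x r
    have h2 : volume (F ∩ ball x r) ≠ ⊤ := measure_ne_top_of_subset inter_subset_right h1
    have h3 : volume (F ∩ ball x r) + volume (Fᶜ ∩ ball x r) = volume (ball x r) := by
      rw [inter_comm F, inter_comm Fᶜ, ← sdiff_eq]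
      exact measure_inter_add_sdiff _ hF
    have h4 : volume (Fᶜ ∩ ball x r) = volume (ball x r) - volume (F ∩ ball x r) :=
      ENNReal.eq_sub_of_add_eq h2 (by rw [add_comm]; exact h3)
    rw [h4, ENNReal.sub_div (by intros; exact h0), ENNReal.div_self h0 h1]
  have imp : ∀ (F : Set (EucSp n)), MeasurableSet F → ∀ x : EucSp n, ∀ t : ℝ≥0∞,
      DensityEq n F x t → DensityEq n Fᶜ x (1 - t) := by
    intro F hF x t h
    have h1 : Tendsto (fun r : ℝ => 1 - volume (F ∩ ball x r) / volume (ball x r)) (𝓝[>] 0)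
      (𝓝 (1 - t)) := ENNReal.Tendsto.sub tendsto_const_nhds h (Or.inl ENNReal.one_ne_top)
    refine h1.congr' ?_
    filter_upwards [self_mem_nhdsWithin] with r hr
    exact (key F hF x r hr).symm
  ext x
  constructor
  · intro h
    have := imp E hE x 1 h
    rw [tsub_self] at this
    exact this
  · intro h
    have := imp Eᶜ hE.compl x 0 h
    rw [compl_compl, tsub_zero] at this
    exact this

theorem hpF_null (n : ℕ) {E : Set (EucSp n)} (hE : MeasurableSet E) :
    volume (E ∩ densPts n E 0) = 0 := by
  have h := Besicovitch.ae_tendsto_measure_inter_div_of_measurableSet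
    (volume : Measure (EucSp n)) hE
  refine measure_mono_null ?_ h
  rintro x ⟨h1, h2⟩ h3
  simp only [hpF_inter_closedBall, Measure.addHaar_closedBall_eq_addHaar_ball] at h3
  have := tendsto_nhds_unique h3 h2
  simp [h1] at this

/-- small constant -/
noncomputable def hpEps (n : ℕ) : ℝ≥0∞ := (2 * 6 ^ (n+1))⁻¹

theorem hpEps_pos (n : ℕ) : 0 < hpEps n := by
  unfold hpEps
  rw [ENNReal.inv_pos]
  finiteness

theorem hpEps_le (n : ℕ) : hpEps n ≤ 2⁻¹ := by
  unfold hpEps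
  rw [ENNReal.inv_le_inv]
  calc (2 : ℝ≥0∞) = 2 * 1 := by simp
    _ ≤ _ := by gcongr; exact one_le_pow₀ (by norm_num)

/-- uniform density sets -/
def hpUnif (n : ℕ) (E : Set (EucSp n)) (m : ℕ) : Set (EucSp n) :=
  {x | ∀ ρ ∈ Ioo (0:ℝ) (1 / (m+1)), volume (E ∩ ball x ρ) ≤ hpEps n * volume (ball x ρ)}

theorem hpUnif_closed (n : ℕ) (E : Set (EucSp n)) (m : ℕ) : IsClosed (hpUnif n E m) := by
  rw [← closure_subset_iff_isClosed]
  intro x hx ρ hρ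
  have hlim : Tendsto (fun r : ℝ => hpEps n * (ENNReal.ofReal (r ^ (n+1)) * volume (ball (0 : EucSp n) 1)))
      (𝓝[>] ρ) (𝓝 (hpEps n * (ENNReal.ofReal (ρ ^ (n+1)) * volume (ball (0 : EucSp n) 1)))) := by
    refine ENNReal.Tendsto.const_mul ?_ (Or.inr ?_)
    · refine ENNReal.Tendsto.mul_const ?_ (Or.inr (hpF_ball_ne_top n 0 1))
      refine ENNReal.tendsto_ofReal ?_
      exact (Continuous.tendsto (by fun_prop) ρ).mono_left nhdsWithin_le_nhds
    · exact ((hpEps_le n).trans_lt (by simp)).ne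
  rw [hpF_ball n x hρ.1.le]
  refine ge_of_tendsto hlim ?_
  filter_upwards [Ioo_mem_nhdsGT hρ.2] with r hr
  obtain ⟨y, hy, hd⟩ := Metric.mem_closure_iff.1 hx (r - ρ) (by linarith [hr.1])
  have h1 := hy r ⟨hρ.1.trans hr.1, hr.2⟩
  rw [hpF_ball n y (hρ.1.trans hr.1).le] at h1
  refine le_trans (measure_mono (inter_subset_inter_right _ ?_)) h1
  apply ball_subset_ball'
  linarith

theorem hpUnif_cover (n : ℕ) (E : Set (EucSp n)) : densPts n E 0 ⊆ ⋃ m, hpUnif n E m := by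
  intro x hx
  have h1 : ∀ᶠ r : ℝ in 𝓝[>] 0, volume (E ∩ ball x r) / volume (ball x r) < hpEps n :=
    Tendsto.eventually_lt_const (hpEps_pos n) hx
  obtain ⟨δ, hδ, h2⟩ := (mem_nhdsGT_iff_exists_Ioo_subset).1 h1
  obtain ⟨m, hm⟩ := exists_nat_one_div_lt (show (0:ℝ) < δ from hδ)
  refine mem_iUnion.2 ⟨m, fun ρ hρ => ?_⟩
  have h3 := h2 ⟨hρ.1, hρ.2.trans hm⟩
  have h4 : volume (E ∩ ball x ρ) / volume (ball x ρ) < hpEps n := h3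
  rw [ENNReal.div_lt_iff (Or.inl (hpF_ball_ne_zero n x hρ.1)) (Or.inl (hpF_ball_ne_top n x ρ))] at h4
  exact h4.le

theorem hpUnif_disj (n : ℕ) (E : Set (EucSp n)) (m : ℕ) : Disjoint (hpUnif n E m) (densPts n Eᶜ 0) := by
  rw [Set.disjoint_left]
  intro x hx hx'
  obtain ⟨k, hk⟩ := mem_iUnion.1 (hpUnif_cover n _ hx')
  have h1 : ∀ᶠ r : ℝ in 𝓝[>] 0, volume (Eᶜ ∩ ball x r) / volume (ball x r) < hpEps n :=
    Tendsto.eventually_lt_const (hpEps_pos n) hx'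
  have h5 : ∀ᶠ r : ℝ in 𝓝[>] 0, r ∈ Ioo (0:ℝ) (1/(m+1)) := Ioo_mem_nhdsGT (by positivity)
  obtain ⟨r, h2, hr⟩ := (h1.and h5).exists
  have h0 := hpF_ball_ne_zero n x hr.1
  have ht := hpF_ball_ne_top n x r
  rw [ENNReal.div_lt_iff (Or.inl h0) (Or.inl ht)] at h2
  have h3 := hx r hr
  have : volume (ball x r) < volume (ball x r) := by
    calc volume (ball x r) ≤ volume ((E ∩ ball x r) ∪ (Eᶜ ∩ ball x r)) := by
          rw [← union_inter_distrib_right]; simp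
      _ ≤ volume (E ∩ ball x r) + volume (Eᶜ ∩ ball x r) := measure_union_le _ _
      _ < hpEps n * volume (ball x r) + hpEps n * volume (ball x r) := by
          apply ENNReal.add_lt_add_of_le_of_lt _ h3 h2
          exact measure_ne_top_of_subset inter_subset_right ht
      _ ≤ 2⁻¹ * volume (ball x r) + 2⁻¹ * volume (ball x r) := by
          gcongr <;> exact hpEps_le n
      _ = volume (ball x r) := by rw [← add_mul, ENNReal.inv_two_add_inv_two, one_mul]
  exact lt_irrefl _ this

/-! ### The null set of bad lines -/

theorem hpF_nullT (n : ℕ) {E O Z : Set (EucSp n)} (hO : volume (O ∩ E) = 0) {u : EucSp n}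
    (hu : ‖u‖ = 1) {η : ℝ} (hη : 0 < η) (m : ℕ) (hZ1 : Z ⊆ hpUnif n Eᶜ m)
    (hZ2 : ∀ x ∈ Z, ∀ t ∈ Ioo 0 η, x + t • u ∈ O)
    (hZ3 : ∀ x ∈ Z, ∀ y ∈ Z, ⟪x, u⟫ - ⟪y, u⟫ ≤ η / 2) :
    volume {x | ∃ s : ℝ, x + s • u ∈ Z} = 0 := by
  set T := {x | ∃ s : ℝ, x + s • u ∈ Z} with hT
  by_contra hne
  have hres : (volume : Measure (EucSp n)).restrict T ≠ 0 := by
    rwa [Ne, Measure.restrict_eq_zero]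
  have : NeBot (ae ((volume : Measure (EucSp n)).restrict T)) := ae_neBot.2 hres
  obtain ⟨p, hp⟩ := (Besicovitch.ae_tendsto_measure_inter_div
    (volume : Measure (EucSp n)) T).exists
  have huu : ⟪u, u⟫ = 1 := by rw [real_inner_self_eq_norm_sq, hu]; norm_num
  have hiu : ∀ w : EucSp n, |⟪w, u⟫| ≤ ‖w‖ := fun w => by
    have := abs_real_inner_le_norm w u
    rwa [hu, mul_one] at this
  have h1 : ∀ᶠ r : ℝ in 𝓝[>] 0, 2⁻¹ < volume (T ∩ closedBall p r) / volume (closedBall p r) :=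
    Tendsto.eventually_const_lt (by simp) hp
  have h2 : ∀ᶠ r : ℝ in 𝓝[>] 0, r ∈ Ioo (0:ℝ) (min (1/(m+1)/6) (η/6)) :=
    Ioo_mem_nhdsGT (by positivity)
  obtain ⟨r, hr1, hr0, hr2⟩ := (h1.and h2).exists
  have hr3 : 6 * r < 1/(m+1) := by
    have := hr2.trans_le (min_le_left _ _); linarith
  have hr4 : 6 * r < η := by
    have := hr2.trans_le (min_le_right _ _); linarith
  rw [Measure.addHaar_closedBall_eq_addHaar_ball,
    ENNReal.lt_div_iff_mul_lt (Or.inl (hpF_ball_ne_zero n p hr0)) (Or.inl (hpF_ball_ne_top n p r))] at hr1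
  set Y := {y ∈ Z | ∃ s : ℝ, y + s • u ∈ closedBall p r} with hY
  have hYof : ∀ w ∈ T ∩ closedBall p r, ∃ s : ℝ, w + s • u ∈ Y := by
    rintro w ⟨⟨s, hs⟩, hw⟩
    exact ⟨s, hs, -s, by simpa using hw⟩
  have hYne : Y.Nonempty := by
    have : (T ∩ closedBall p r).Nonempty := by
      apply nonempty_of_measure_ne_zero (μ := volume)
      exact ne_bot_of_gt hr1
    obtain ⟨w, hw⟩ := this
    obtain ⟨s, hs⟩ := hYof w hw
    exact ⟨_, hs⟩
  obtain ⟨y0, hy0⟩ := hYne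
  obtain ⟨x, hxY, hx⟩ : ∃ x ∈ Y, ∀ y ∈ Y, ⟪y, u⟫ ≤ ⟪x, u⟫ + r / 2 := by
    have hbd : BddAbove ((fun y : EucSp n => ⟪y, u⟫) '' Y) := by
      refine ⟨⟪y0, u⟫ + η/2, ?_⟩
      rintro _ ⟨y, hy, rfl⟩
      have := hZ3 y hy.1 y0 hy0.1
      simp only
      linarith
    obtain ⟨_, ⟨x, hx, rfl⟩, hlt⟩ := exists_lt_of_lt_csSup (s := (fun y : EucSp n => ⟪y, u⟫) '' Y)
      ⟨_, y0, hy0, rfl⟩ (show sSup ((fun y : EucSp n => ⟪y, u⟫) '' Y) - r/2 < _ by linarith)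
    refine ⟨x, hx, fun y hy => ?_⟩
    have := le_csSup hbd ⟨y, hy, rfl⟩
    simp only at this hlt
    linarith
  obtain ⟨hxZ, sx, hsx⟩ := hxY
  set c : ℝ := ⟪x, u⟫ + 2 * r - ⟪p, u⟫ with hc
  have hsub : (fun w => w + c • u) '' (T ∩ closedBall p r) ⊆ (O ∩ E) ∪ (Eᶜ ∩ ball x (6*r)) := by
    rintro _ ⟨w, hw, rfl⟩
    obtain ⟨s, hs⟩ := hYof w hw
    have hwp : |⟪w, u⟫ - ⟪p, u⟫| ≤ r := by
      rw [← inner_sub_left]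
      exact (hiu _).trans (by simpa [dist_eq_norm] using hw.2)
    have hxp : |⟪x, u⟫ + sx - ⟪p, u⟫| ≤ r := by
      have : ⟪x, u⟫ + sx - ⟪p, u⟫ = ⟪x + sx • u - p, u⟫ := by
        rw [inner_sub_left, inner_add_left, real_inner_smul_left, huu]; ring
      rw [this]
      exact (hiu _).trans (by simpa [dist_eq_norm] using hsx)
    have hyx := hx _ hs
    have hxy := hZ3 x hxZ _ hs.1
    rw [inner_add_left, real_inner_smul_left, huu] at hyx hxy
    rw [abs_le] at hwp hxp
    have hmO : w + c • u ∈ O := by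
      have := hZ2 _ hs.1 (c - s) ⟨by linarith, by linarith⟩
      convert this using 1
      module
    have hmB : w + c • u ∈ ball x (6*r) := by
      rw [mem_ball, dist_eq_norm]
      have e : w + c • u - x = (w - p) + (p - (x + sx • u)) + (c + sx) • u := by module
      rw [e]
      have n1 : ‖w - p‖ ≤ r := by simpa [dist_eq_norm] using hw.2
      have n2 : ‖p - (x + sx • u)‖ ≤ r := by
        rw [norm_sub_rev]; simpa [dist_eq_norm] using hsx
      have n3 : ‖(c + sx) • u‖ ≤ 3 * r := by
        rw [norm_smul, hu, mul_one, Real.norm_eq_abs, abs_le]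
        constructor <;> linarith
      calc _ ≤ ‖w - p‖ + ‖p - (x + sx • u)‖ + ‖(c + sx) • u‖ := norm_add₃_le
        _ < 6 * r := by linarith
    by_cases hE : w + c • u ∈ E
    · exact Or.inl ⟨hmO, hE⟩
    · exact Or.inr ⟨hE, hmB⟩
  have hx6 := hZ1 hxZ (6*r) ⟨by linarith, hr3⟩
  have : volume (T ∩ closedBall p r) ≤ 2⁻¹ * volume (ball p r) := by
    calc volume (T ∩ closedBall p r) = volume ((fun w => w + c • u) '' (T ∩ closedBall p r)) := by
          rw [image_add_right, measure_preimage_add_right]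
      _ ≤ _ := measure_mono hsub
      _ ≤ _ := measure_union_le _ _
      _ ≤ 0 + hpEps n * volume (ball x (6*r)) := by rw [hO]; gcongr
      _ = 2⁻¹ * volume (ball p r) := by
          rw [hpF_ball n x (by linarith), hpF_ball n p hr0.le, zero_add, ← mul_assoc, ← mul_assoc, mul_pow,
            ENNReal.ofReal_mul (by positivity), ENNReal.ofReal_pow (by norm_num), ← mul_assoc]
          congr 2
          unfold hpEps
          rw [ENNReal.mul_inv (by simp) (by simp), mul_assoc]
          have : ENNReal.ofReal 6 = 6 := by simp
          rw [this, ENNReal.inv_mul_cancel (by simp) (by finiteness), mul_one]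
  exact absurd hr1 (not_lt.2 this)

theorem hpF_nullN (n : ℕ) {E : Set (EucSp n)} (hE : MeasurableSet E) {u : EucSp n}
    (hu : ‖u‖ = 1) :
    volume {x | ∃ s : ℝ, x + s • u ∈ densPts n Eᶜ 0 ∧ ∃ η > (0:ℝ), ∀ t ∈ Ioo 0 η,
      x + s • u + t • u ∈ densPts n E 0} = 0 := by
  let Z : ℕ → ℕ → ℤ → Set (EucSp n) := fun m k j => {x | x ∈ hpUnif n Eᶜ m ∧
    (∀ t ∈ Ioo (0:ℝ) (1/(k+1)), x + t • u ∈ densPts n E 0) ∧ ⌊⟪x, u⟫ * (2 * (k+1))⌋ = j}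
  have hnull : volume (⋃ (m : ℕ) (k : ℕ) (j : ℤ), {x | ∃ s : ℝ, x + s • u ∈ Z m k j}) = 0 := by
    simp only [measure_iUnion_null_iff]
    intro m k j
    refine hpF_nullT n (O := densPts n E 0) (E := E) (by rw [inter_comm]; exact hpF_null n hE) hu
      (η := 1/(k+1)) (by positivity) m (fun x hx => hx.1) (fun x hx => hx.2.1) ?_
    intro x hx y hy
    have h1 := Int.floor_le (⟪y, u⟫ * (2 * ((k:ℝ)+1)))
    have h2 := Int.lt_floor_add_one (⟪x, u⟫ * (2 * ((k:ℝ)+1)))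
    rw [hy.2.2] at h1
    rw [hx.2.2] at h2
    have hk : (0:ℝ) < k + 1 := by positivity
    rw [div_div, le_div_iff₀ (by positivity)]
    linarith
  refine measure_mono_null ?_ hnull
  rintro x ⟨s, h1, η, hη, h2⟩
  obtain ⟨m, hm⟩ := mem_iUnion.1 (hpUnif_cover n _ h1)
  obtain ⟨k, hk⟩ := exists_nat_one_div_lt hη
  simp only [mem_iUnion]
  exact ⟨m, k, _, s, hm, fun t ht => h2 t ⟨ht.1, ht.2.trans hk⟩, rfl⟩

theorem hpF_cross (n : ℕ) {E : Set (EucSp n)} (hE : MeasurableSet E) {u : EucSp n}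
    (hu : ‖u‖ = 1) {ℓ : ℝ} (hℓ : 0 ≤ ℓ) :
    ∀ᵐ x : EucSp n, x ∈ E → x + ℓ • u ∉ E → ∃ s ∈ Icc 0 ℓ, x + s • u ∈ essBdry n E := by
  have hu' : ‖-u‖ = 1 := by rwa [norm_neg]
  have a1 := measure_eq_zero_iff_ae_notMem.1 (hpF_nullN n hE hu)
  have a2 := measure_eq_zero_iff_ae_notMem.1 (hpF_nullN n hE hu')
  have a3 := measure_eq_zero_iff_ae_notMem.1 (hpF_nullN n hE.compl hu)
  have a4 := measure_eq_zero_iff_ae_notMem.1 (hpF_nullN n hE.compl hu')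
  have a5 := measure_eq_zero_iff_ae_notMem.1 (hpF_null n hE)
  have a6 : ∀ᵐ x : EucSp n, x + ℓ • u ∉ Eᶜ ∩ densPts n Eᶜ 0 := by
    have := (measurePreserving_add_right (volume : Measure (EucSp n)) (ℓ • u)).quasiMeasurePreserving
    exact this.ae (measure_eq_zero_iff_ae_notMem.1 (hpF_null n hE.compl))
  filter_upwards [a1, a2, a3, a4, a5, a6] with x h1 h2 h3 h4 h5 h6 hx hxl
  by_contra! hcon
  have hcov : ∀ s ∈ Icc 0 ℓ, x + s • u ∈ densPts n Eᶜ 0 ∪ densPts n E 0 := by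
    intro s hs
    have := hcon s hs
    rw [essBdry, mem_compl_iff, not_not, hpF_dens_compl n hE] at this
    exact this.symm
  have hdisjInOut : Disjoint (densPts n Eᶜ 0) (densPts n E 0) := by
    rw [Set.disjoint_left]
    intro y hy hy'
    obtain ⟨m, hm⟩ := mem_iUnion.1 (hpUnif_cover n _ hy')
    exact (hpUnif_disj n E m).le_bot ⟨hm, hy⟩
  have h0I : x ∈ densPts n Eᶜ 0 := by
    have := hcov 0 ⟨le_refl _, hℓ⟩
    simp only [zero_smul, add_zero] at this
    exact this.resolve_right fun h => h5 ⟨hx, h⟩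
  have hlI : x + ℓ • u ∉ densPts n Eᶜ 0 := fun h => h6 ⟨hxl, h⟩
  obtain ⟨s, η, hη, h⟩ := hpF_line (g := fun s : ℝ => x + s • u) (by fun_prop) hℓ
    (I := densPts n Eᶜ 0) (O := densPts n E 0) (hpUnif_closed n Eᶜ) (hpUnif_closed n E)
    (hpUnif_cover n Eᶜ) (hpUnif_cover n E) (fun m => by simpa using hpUnif_disj n Eᶜ m)
    (hpUnif_disj n E) hdisjInOut hcov (by simp [h0I, hlI])
  have e1 : ∀ t : ℝ, x + (s + t) • u = x + s • u + t • u := fun t => by module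
  have e2 : ∀ t : ℝ, x + (s - t) • u = x + (-s) • (-u) + t • (-u) := fun t => by module
  have e3 : x + s • u = x + (-s) • (-u) := by module
  rcases h with ⟨p, q⟩ | ⟨p, q⟩ | ⟨p, q⟩ | ⟨p, q⟩
  · exact h1 ⟨s, p, η, hη, fun t ht => by rw [← e1]; exact q t ht⟩
  · exact h2 ⟨-s, by rw [← e3]; exact p, η, hη, fun t ht => by rw [← e2]; exact q t ht⟩
  · exact h3 ⟨s, by rwa [compl_compl], η, hη, fun t ht => by rw [← e1]; exact q t ht⟩
  · exact h4 ⟨-s, by rw [← e3, compl_compl]; exact p, η, hη, fun t ht => by rw [← e2]; exact q t ht⟩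

/-! ### Tubes -/

noncomputable def hpC (n : ℕ) : ℝ≥0∞ := ENNReal.ofReal (5 * 3 ^ (n+1)) * volume (ball (0 : EucSp n) 1)

theorem hpC_ne_top (n : ℕ) : hpC n ≠ ⊤ :=
  ENNReal.mul_ne_top ENNReal.ofReal_ne_top (hpF_ball_ne_top n 0 1)

theorem hpC_ne_zero (n : ℕ) : hpC n ≠ 0 := by
  refine mul_ne_zero ?_ (hpF_ball_ne_zero n 0 one_pos)
  rw [Ne, ENNReal.ofReal_eq_zero, not_le]; positivity

/-- tube over a set -/
def hpTube (n : ℕ) (u : EucSp n) (ℓ : ℝ) (S : Set (EucSp n)) : Set (EucSp n) :=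
  {x | ∃ s ∈ Icc 0 ℓ, x + s • u ∈ S}

theorem hpTube_pos (n : ℕ) {u : EucSp n} (hu : ‖u‖ = 1) {ℓ : ℝ} (hℓ : 0 < ℓ) (t : Set (EucSp n))
    {d : ℝ} (hd : 0 < d) (hdℓ : d ≤ 2 * ℓ) (ht : ediam t ≤ ENNReal.ofReal d) :
    volume (hpTube n u ℓ t) ≤ hpC n * ENNReal.ofReal ℓ * ENNReal.ofReal (d ^ n) := by
  rcases t.eq_empty_or_nonempty with rfl | ⟨p, hp⟩
  · simp [hpTube]
  set M := ⌊ℓ / d⌋₊ + 1 with hM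
  have hsub : hpTube n u ℓ t ⊆ ⋃ j ∈ Finset.range M, ball (p - ((j : ℝ) * d) • u) (3 * d) := by
    rintro x ⟨s, hs, hx⟩
    simp only [mem_iUnion]
    have hsd : 0 ≤ s / d := div_nonneg hs.1 hd.le
    refine ⟨⌊s / d⌋₊, ?_, ?_⟩
    · rw [Finset.mem_range, hM, Nat.lt_succ_iff]
      apply Nat.floor_le_floor
      gcongr
      exact hs.2
    · rw [mem_ball, dist_eq_norm]
      have h1 := Nat.floor_le hsd
      have h2 := Nat.lt_floor_add_one (s / d)
      rw [le_div_iff₀ hd] at h1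
      rw [div_lt_iff₀ hd] at h2
      have e : x - (p - ((⌊s / d⌋₊ : ℝ) * d) • u) = (x + s • u - p) + ((⌊s / d⌋₊ : ℝ) * d - s) • u := by
        module
      rw [e]
      have n1 : ‖x + s • u - p‖ ≤ d := by
        rw [← dist_eq_norm]
        have := (Metric.edist_le_ediam_of_mem hx hp).trans ht
        rwa [edist_dist, ENNReal.ofReal_le_ofReal_iff hd.le] at this
      have n2 : ‖((⌊s / d⌋₊ : ℝ) * d - s) • u‖ ≤ d := by
        rw [norm_smul, hu, mul_one, Real.norm_eq_abs, abs_le]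
        constructor <;> linarith
      calc _ ≤ _ := norm_add_le _ _
        _ < 3 * d := by linarith
  calc volume (hpTube n u ℓ t) ≤ _ := measure_mono hsub
    _ ≤ ∑ j ∈ Finset.range M, volume (ball (p - ((j : ℝ) * d) • u) (3 * d)) :=
        measure_biUnion_finset_le _ _
    _ = M * (ENNReal.ofReal ((3*d)^(n+1)) * volume (ball (0 : EucSp n) 1)) := by
        rw [Finset.sum_congr rfl fun j _ => hpF_ball n _ (by positivity)]
        simp
    _ = ENNReal.ofReal (M * (3*d)^(n+1)) * volume (ball (0 : EucSp n) 1) := by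
        rw [ENNReal.ofReal_mul (by positivity), ENNReal.ofReal_natCast, mul_assoc]
    _ ≤ ENNReal.ofReal (5 * 3^(n+1) * ℓ * d ^ n) * volume (ball (0 : EucSp n) 1) := by
        gcongr ENNReal.ofReal ?_ * _
        have h1 : (M : ℝ) ≤ ℓ / d + 1 := by
          rw [hM]; push_cast
          linarith [Nat.floor_le (show 0 ≤ ℓ / d by positivity)]
        have h2 : (M : ℝ) * d ≤ 5 * ℓ := by
          calc (M : ℝ) * d ≤ (ℓ / d + 1) * d := by gcongr
            _ = ℓ + d := by field_simp
            _ ≤ 5 * ℓ := by linarith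
        calc (M : ℝ) * (3*d)^(n+1) = (M * d) * (3^(n+1) * d^n) := by ring
          _ ≤ (5 * ℓ) * (3^(n+1) * d^n) := by gcongr
          _ = _ := by ring
    _ = _ := by
        rw [hpC, ENNReal.ofReal_mul (by positivity), ENNReal.ofReal_mul (by positivity)]
        ring

theorem hpTube_le (n : ℕ) {u : EucSp n} (hu : ‖u‖ = 1) {ℓ : ℝ} (hℓ : 0 < ℓ) (t : Set (EucSp n))
    (ht : ediam t ≤ ENNReal.ofReal ℓ) :
    volume (hpTube n u ℓ t) ≤ hpC n * ENNReal.ofReal ℓ * ⨆ _ : t.Nonempty, ediam t ^ (n : ℝ) := by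
  by_cases hne : t.Nonempty
  swap
  · rw [not_nonempty_iff_eq_empty] at hne
    simp [hpTube, hne]
  rw [iSup_pos hne, ENNReal.rpow_natCast]
  set d := (ediam t).toReal with hd
  have hfin : ediam t ≠ ⊤ := ne_top_of_le_ne_top ENNReal.ofReal_ne_top ht
  have hdt : ediam t = ENNReal.ofReal d := (ENNReal.ofReal_toReal hfin).symm
  have hd0 : 0 ≤ d := ENNReal.toReal_nonneg
  have hdl : d ≤ ℓ := by
    rwa [hdt, ENNReal.ofReal_le_ofReal_iff hℓ.le] at ht
  rw [hdt, ← ENNReal.ofReal_pow hd0]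
  have hlim : Tendsto (fun e : ℝ => hpC n * ENNReal.ofReal ℓ * ENNReal.ofReal (e ^ n)) (𝓝[>] d)
      (𝓝 (hpC n * ENNReal.ofReal ℓ * ENNReal.ofReal (d ^ n))) := by
    refine ENNReal.Tendsto.const_mul ?_ (Or.inr (ENNReal.mul_ne_top (hpC_ne_top n) ENNReal.ofReal_ne_top))
    refine ENNReal.tendsto_ofReal ?_
    exact (Continuous.tendsto (by fun_prop) d).mono_left nhdsWithin_le_nhds
  refine ge_of_tendsto hlim ?_
  filter_upwards [Ioo_mem_nhdsGT (show d < 2 * ℓ by linarith)] with e he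
  refine hpTube_pos n hu hℓ t (hd0.trans_lt he.1) he.2.le ?_
  rw [hdt]
  exact ENNReal.ofReal_le_ofReal he.1.le

theorem hpTube_haus (n : ℕ) {u : EucSp n} (hu : ‖u‖ = 1) {ℓ : ℝ} (hℓ : 0 < ℓ) (S : Set (EucSp n)) :
    volume (hpTube n u ℓ S) ≤ hpC n * ENNReal.ofReal ℓ * μH[n] S := by
  have hc0 : hpC n * ENNReal.ofReal ℓ ≠ 0 := mul_ne_zero (hpC_ne_zero n) (by simpa using hℓ)
  have hct : hpC n * ENNReal.ofReal ℓ ≠ ⊤ := ENNReal.mul_ne_top (hpC_ne_top n) ENNReal.ofReal_ne_top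
  rw [mul_comm, ← ENNReal.div_le_iff hc0 hct, Measure.hausdorffMeasure_apply]
  refine le_trans ?_ (le_iSup₂ (f := fun (r : ℝ≥0∞) (_ : 0 < r) =>
        ⨅ (t : ℕ → Set (EucSp n)) (_ : S ⊆ ⋃ n, t n) (_ : ∀ n, ediam (t n) ≤ r),
          ∑' m, ⨆ _ : (t m).Nonempty, ediam (t m) ^ (n : ℝ)) (ENNReal.ofReal ℓ) (by simpa using hℓ))
  refine le_iInf fun t => le_iInf fun hS => le_iInf fun hd => ?_
  rw [ENNReal.div_le_iff hc0 hct, mul_comm, ← ENNReal.tsum_mul_left]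
  calc volume (hpTube n u ℓ S) ≤ volume (⋃ i, hpTube n u ℓ (t i)) := by
        apply measure_mono
        rintro x ⟨s, hs, hx⟩
        obtain ⟨i, hi⟩ := mem_iUnion.1 (hS hx)
        exact mem_iUnion.2 ⟨i, s, hs, hi⟩
    _ ≤ ∑' i, volume (hpTube n u ℓ (t i)) := measure_iUnion_le _
    _ ≤ _ := ENNReal.tsum_le_tsum fun i => hpTube_le n hu hℓ (t i) (hd i)

/-! ### The relative isoperimetric inequality -/

theorem hpF_shift (n : ℕ) {E : Set (EucSp n)} (hE : MeasurableSet E) (z : EucSp n) {r : ℝ}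
    (v : EucSp n) (hv : ‖v‖ ≤ 2 * r) :
    volume {x | x ∈ E ∩ ball z r ∧ x + v ∈ ball z r \ E} ≤
      hpC n * ENNReal.ofReal (2 * r) * μH[n] (ball z r ∩ essBdry n E) := by
  rcases eq_or_ne v 0 with rfl | hv0
  · have : {x | x ∈ E ∩ ball z r ∧ x + 0 ∈ ball z r \ E} = ∅ := by
      ext x; simp; tauto
    rw [this]; simp
  have hl : 0 < ‖v‖ := norm_pos_iff.2 hv0
  set u := ‖v‖⁻¹ • v with hu
  have hu1 : ‖u‖ = 1 := by rw [hu, norm_smul]; simp [hl.ne']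
  have huv : ‖v‖ • u = v := by rw [hu, smul_smul, mul_inv_cancel₀ hl.ne', one_smul]
  have hae : ({x | x ∈ E ∩ ball z r ∧ x + v ∈ ball z r \ E} : Set (EucSp n)) ≤ᵐ[volume]
      hpTube n u ‖v‖ (ball z r ∩ essBdry n E) := by
    filter_upwards [hpF_cross n hE hu1 hl.le] with x hx hm
    rw [huv] at hx
    obtain ⟨s, hs, hb⟩ := hx hm.1.1 hm.2.2
    refine ⟨s, hs, ?_, hb⟩
    have hseg := (convex_ball z r).segment_subset hm.1.2 hm.2.1
    apply hseg
    rw [segment_eq_image']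
    refine ⟨s / ‖v‖, ⟨div_nonneg hs.1 hl.le, (div_le_one hl).2 hs.2⟩, ?_⟩
    simp only [add_sub_cancel_left, hu, smul_smul]
    rw [div_eq_mul_inv]
  calc _ ≤ _ := measure_mono_ae hae
    _ ≤ _ := hpTube_haus n hu1 hl _
    _ ≤ _ := by gcongr

theorem hpF_isop (n : ℕ) (D : ℕ → Set (EucSp n)) (hD : ∀ k, MeasurableSet (D k)) (z : EucSp n) {r : ℝ}
    (hr : 0 < r) :
    volume ((⋃ k, D k) ∩ ball z r) * volume ((⋃ k, D k)ᶜ ∩ ball z r) ≤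
      volume (ball (0 : EucSp n) (2 * r)) *
       (hpC n * ENNReal.ofReal (2 * r) * ∑' k, μH[n] (ball z r ∩ essBdry n (D k))) := by
  set G := ⋃ k, D k with hG
  have hGm : MeasurableSet G := MeasurableSet.iUnion hD
  set A := G ∩ ball z r
  set B := Gᶜ ∩ ball z r
  have hA : MeasurableSet A := hGm.inter measurableSet_ball
  have hB : MeasurableSet B := hGm.compl.inter measurableSet_ball
  have hmp := measurePreserving_prod_add (volume : Measure (EucSp n)) (volume : Measure (EucSp n))
  have h1 : volume A * volume B = (volume.prod volume)
      ((fun z : EucSp n × EucSp n => (z.1, z.1 + z.2)) ⁻¹' (A ×ˢ B)) := by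
    rw [hmp.measure_preimage (hA.prod hB).nullMeasurableSet, Measure.prod_prod]
  have hm : MeasurableSet ((fun z : EucSp n × EucSp n => (z.1, z.1 + z.2)) ⁻¹' (A ×ˢ B)) :=
    hmp.measurable (hA.prod hB)
  rw [h1, Measure.prod_apply_symm hm, mul_comm (volume (ball _ _)), ← setLIntegral_const,
    ← lintegral_indicator measurableSet_ball]
  refine lintegral_mono fun v => ?_
  by_cases hv : v ∈ ball (0 : EucSp n) (2 * r)
  · rw [indicator_of_mem hv]
    have hv' : ‖v‖ ≤ 2 * r := by simpa using (mem_ball.1 hv).le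
    calc _ ≤ volume (⋃ k, {x | x ∈ D k ∩ ball z r ∧ x + v ∈ ball z r \ D k}) := by
          apply measure_mono
          rintro x ⟨⟨hx1, hx2⟩, hx3, hx4⟩
          obtain ⟨k, hk⟩ := mem_iUnion.1 hx1
          exact mem_iUnion.2 ⟨k, ⟨hk, hx2⟩, hx4, fun h => hx3 (mem_iUnion.2 ⟨k, h⟩)⟩
      _ ≤ _ := measure_iUnion_le _
      _ ≤ ∑' k, hpC n * ENNReal.ofReal (2 * r) * μH[n] (ball z r ∩ essBdry n (D k)) :=
          ENNReal.tsum_le_tsum fun k => hpF_shift n (hD k) z v hv'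
      _ = _ := ENNReal.tsum_mul_left
  · have : (fun x : EucSp n => (x, v)) ⁻¹' ((fun z : EucSp n × EucSp n => (z.1, z.1 + z.2)) ⁻¹' (A ×ˢ B)) = ∅ := by
      ext x
      simp only [mem_preimage, mem_prod, mem_empty_iff_false, iff_false]
      rintro ⟨⟨_, hx2⟩, _, hx4⟩
      replace hx2 : x ∈ ball z r := hx2
      replace hx4 : x + v ∈ ball z r := hx4
      apply hv
      rw [mem_ball] at *
      have := dist_triangle_right (x + v) x z
      rw [dist_zero_right]
      rw [dist_eq_norm (x+v) x, add_sub_cancel_left] at this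
      linarith
    rw [this]; simp

/-! ### Covering argument -/

theorem hpF_vitali (n : ℕ) (μ : Measure (EucSp n)) (S : Set (EucSp n)) (a : ℝ≥0∞) (ha : a ≠ 0)
    (ha' : a ≠ ⊤)
    (h : ∀ x ∈ S, ∀ δ > (0:ℝ), ∃ r ∈ Ioo 0 δ, a * ENNReal.ofReal (r ^ n) ≤ μ (closedBall x r)) :
    μH[n] S ≤ ENNReal.ofReal (10 ^ n) * a⁻¹ * μ univ := by
  have step : ∀ δ > (0:ℝ), ∃ (u : Set (EucSp n)) (r : EucSp n → ℝ), u.Countable ∧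
      (∀ x ∈ u, r x ∈ Ioo 0 δ ∧ a * ENNReal.ofReal (r x ^ n) ≤ μ (closedBall x (r x))) ∧
      u.PairwiseDisjoint (fun x => closedBall x (r x)) ∧
      S ⊆ ⋃ x : u, closedBall (x : EucSp n) (5 * r x) := by
    intro δ hδ
    choose! r hr hr' using fun x hx => h x hx δ hδ
    obtain ⟨u, hu, hd, hc⟩ := Vitali.exists_disjoint_subfamily_covering_enlargement_closedBall
      S id r δ (fun x hx => (hr x hx).2.le) 5 (by norm_num)
    refine ⟨u, r, ?_, fun x hx => ⟨hr x (hu hx), hr' x (hu hx)⟩, hd, ?_⟩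
    · apply hd.countable_of_nonempty_interior
      intro x hx
      refine ⟨x, ?_⟩
      apply ball_subset_interior_closedBall
      exact mem_ball_self (hr x (hu hx)).1
    · intro x hx
      obtain ⟨b, hb, hsub⟩ := hc x hx
      exact mem_iUnion.2 ⟨⟨b, hb⟩, hsub (mem_closedBall_self (hr x hx).1.le)⟩
  choose u r hcount hr hd hS using fun j : ℕ => step (1 / ((j:ℝ) + 1)) (by positivity)
  have (j : ℕ) : Countable (u j) := (hcount j).to_subtype
  have hdiam : ∀ j, ∀ x : u j, ediam (closedBall (x : EucSp n) (5 * r j x)) ≤ ENNReal.ofReal (10 * r j x) := by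
    intro j x
    refine Metric.ediam_le fun y hy z hz => ?_
    rw [edist_dist]
    apply ENNReal.ofReal_le_ofReal
    have h1 := mem_closedBall.1 hy
    have h2 := mem_closedBall'.1 hz
    linarith [dist_triangle y x z]
  refine (Measure.hausdorffMeasure_le_liminf_tsum (n : ℝ) S (l := atTop)
    (fun j : ℕ => ENNReal.ofReal (10 * (1 / ((j:ℝ)+1)))) ?_
    (fun j (x : u j) => closedBall (x : EucSp n) (5 * r j x)) ?_ ?_).trans ?_
  · rw [← ENNReal.ofReal_zero]
    refine ENNReal.tendsto_ofReal ?_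
    have := (tendsto_one_div_add_atTop_nhds_zero_nat (𝕜 := ℝ)).const_mul 10
    simpa using this
  · refine Eventually.of_forall fun j x => (hdiam j x).trans ?_
    apply ENNReal.ofReal_le_ofReal
    linarith [(hr j x x.2).1.2]
  · exact Eventually.of_forall fun j => hS j
  · refine (liminf_le_liminf (v := fun _ => ENNReal.ofReal (10 ^ n) * a⁻¹ * μ univ)
      (Eventually.of_forall fun j => ?_)).trans (by simp)
    calc ∑' x : u j, ediam (closedBall (x : EucSp n) (5 * r j x)) ^ (n:ℝ)
        ≤ ∑' x : u j, ENNReal.ofReal (10 ^ n) * a⁻¹ * μ (closedBall (x : EucSp n) (r j x)) := by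
          refine ENNReal.tsum_le_tsum fun x => ?_
          rw [ENNReal.rpow_natCast]
          have h1 := (hr j x x.2).1.1
          calc _ ≤ ENNReal.ofReal (10 * r j x) ^ n := by gcongr; exact hdiam j x
            _ = ENNReal.ofReal (10 ^ n) * (a⁻¹ * a * ENNReal.ofReal (r j x ^ n)) := by
                rw [ENNReal.inv_mul_cancel ha ha', one_mul, ← ENNReal.ofReal_pow (by positivity),
                  mul_pow, ENNReal.ofReal_mul (by positivity)]
            _ ≤ ENNReal.ofReal (10 ^ n) * (a⁻¹ * μ (closedBall (x : EucSp n) (r j x))) := by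
                rw [mul_assoc a⁻¹]
                gcongr
                exact (hr j x x.2).2
            _ = _ := by rw [mul_assoc]
      _ = ENNReal.ofReal (10 ^ n) * a⁻¹ * ∑' x : u j, μ (closedBall (x : EucSp n) (r j x)) :=
          ENNReal.tsum_mul_left
      _ ≤ _ := by
          gcongr
          refine tsum_measure_le_measure_univ (fun x => measurableSet_closedBall.nullMeasurableSet) ?_
          intro x y hxy
          exact (hd j x.2 y.2 (fun h => hxy (Subtype.ext h))).aedisjoint

/-! ### Intermediate density -/

theorem hpF_notdens (n : ℕ) {G : Set (EucSp n)} {x : EucSp n} (h : x ∉ densPts n G 0) :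
    ∃ c > (0:ℝ), ∀ δ > (0:ℝ), ∃ r ∈ Ioo 0 δ,
      c * volume.real (ball x r) ≤ volume.real (G ∩ ball x r) := by
  by_contra! hcon
  apply h
  change Tendsto _ _ _
  rw [ENNReal.tendsto_nhds_zero]
  intro ε hε
  obtain ⟨c, hc0, hc⟩ : ∃ c : ℝ, 0 < c ∧ ENNReal.ofReal c ≤ ε := by
    obtain ⟨c, h1, h2⟩ := ENNReal.lt_iff_exists_real_btwn.1 hε
    refine ⟨c, ?_, h2.2.le⟩
    simpa using h2.1
  obtain ⟨δ, hδ, hr⟩ := hcon c hc0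
  filter_upwards [Ioo_mem_nhdsGT hδ] with r hrr
  have h1 := hr r hrr
  refine le_trans ?_ hc
  apply ENNReal.div_le_of_le_mul
  have ht := hpF_ball_ne_top n x r
  have ht' : volume (G ∩ ball x r) ≠ ⊤ := measure_ne_top_of_subset inter_subset_right ht
  rw [← ENNReal.ofReal_toReal ht, ← ENNReal.ofReal_toReal ht', ← ENNReal.ofReal_mul hc0.le]
  exact ENNReal.ofReal_le_ofReal h1.le

theorem hpF_cont (n : ℕ) {F : Set (EucSp n)} (hF : MeasurableSet F) (x : EucSp n) :
    ContinuousOn (fun r : ℝ => volume.real (F ∩ ball x r)) (Ioi 0) ∧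
    ContinuousOn (fun r : ℝ => volume.real (ball x r)) (Ioi 0) := by
  have h2 : ContinuousOn (fun r : ℝ => volume.real (ball x r)) (Ioi 0) := by
    have : ContinuousOn (fun r : ℝ => r ^ (n+1) * volume.real (ball (0 : EucSp n) 1)) (Ioi 0) := by
      fun_prop
    refine this.congr fun r hr => ?_
    have hr : 0 < r := hr
    simp only [Measure.real]
    rw [hpF_ball n x hr.le, ENNReal.toReal_mul, ENNReal.toReal_ofReal (by positivity)]
  refine ⟨?_, h2⟩
  have hle : ∀ r s : ℝ, r ≤ s → volume.real (F ∩ ball x s) - volume.real (F ∩ ball x r) ≤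
      volume.real (ball x s) - volume.real (ball x r) ∧
      volume.real (F ∩ ball x r) ≤ volume.real (F ∩ ball x s) := by
    intro r s hrs
    have e : ∀ t, volume.real (ball x t) = volume.real (F ∩ ball x t) + volume.real (Fᶜ ∩ ball x t) := by
      intro t
      rw [inter_comm F, inter_comm Fᶜ, ← sdiff_eq]
      exact (measureReal_inter_add_sdiff hF (hpF_ball_ne_top n x t)).symm
    have m : ∀ H : Set (EucSp n), volume.real (H ∩ ball x r) ≤ volume.real (H ∩ ball x s) := by
      intro H
      apply measureReal_mono (inter_subset_inter_right _ (ball_subset_ball hrs))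
    refine ⟨?_, m F⟩
    rw [e r, e s]
    linarith [m Fᶜ]
  have hle' : ∀ r s : ℝ, |volume.real (F ∩ ball x s) - volume.real (F ∩ ball x r)| ≤
      |volume.real (ball x s) - volume.real (ball x r)| := by
    intro r s
    rcases le_total r s with h | h
    · obtain ⟨h1, h2⟩ := hle r s h
      rw [abs_of_nonneg (by linarith), abs_of_nonneg (by linarith)]
      exact h1
    · obtain ⟨h1, h2⟩ := hle s r h
      rw [abs_sub_comm, abs_sub_comm (volume.real (ball x s)), abs_of_nonneg (by linarith), abs_of_nonneg (by linarith)]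
      exact h1
  rw [Metric.continuousOn_iff] at *
  intro b hb ε hε
  obtain ⟨δ, hδ, h⟩ := h2 b hb ε hε
  refine ⟨δ, hδ, fun a ha hab => ?_⟩
  refine lt_of_le_of_lt ?_ (h a ha hab)
  rw [Real.dist_eq, Real.dist_eq]
  exact hle' _ _

theorem hpF_mid (n : ℕ) {F : Set (EucSp n)} (hF : MeasurableSet F) {x : EucSp n}
    (h : x ∈ essBdry n F) :
    ∃ c > (0:ℝ), ∀ δ > (0:ℝ), ∃ r ∈ Ioo 0 δ,
      c * volume.real (ball x r) ≤ volume.real (F ∩ ball x r) ∧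
      c * volume.real (ball x r) ≤ volume.real (Fᶜ ∩ ball x r) := by
  rw [essBdry, hpF_dens_compl n hF, mem_compl_iff, mem_union, not_or] at h
  obtain ⟨c1, hc1, h1⟩ := hpF_notdens n h.1
  obtain ⟨c2, hc2, h2⟩ := hpF_notdens n h.2
  refine ⟨min (1/2) (min c1 c2), by positivity, fun δ hδ => ?_⟩
  set c := min (1/2) (min c1 c2) with hc
  have hcc1 : c ≤ c1 := (min_le_right _ _).trans (min_le_left _ _)
  have hcc2 : c ≤ c2 := (min_le_right _ _).trans (min_le_right _ _)
  have hch : c ≤ 1/2 := min_le_left _ _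
  obtain ⟨r1, hr1, h1⟩ := h1 δ hδ
  obtain ⟨r2, hr2, h2⟩ := h2 δ hδ
  have hb : ∀ r, 0 ≤ volume.real (ball x r) := fun r => measureReal_nonneg
  have e : ∀ t, volume.real (ball x t) = volume.real (F ∩ ball x t) + volume.real (Fᶜ ∩ ball x t) := by
    intro t
    rw [inter_comm F, inter_comm Fᶜ, ← sdiff_eq]
    exact (measureReal_inter_add_sdiff hF (hpF_ball_ne_top n x t)).symm
  have h1' := (mul_le_mul_of_nonneg_right hcc1 (hb r1)).trans h1
  have h2' := (mul_le_mul_of_nonneg_right hcc2 (hb r2)).trans h2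
  by_cases hcase : c * volume.real (ball x r2) ≤ volume.real (F ∩ ball x r2)
  · exact ⟨r2, hr2, hcase, h2'⟩
  · push Not at hcase
    obtain ⟨k1, k2⟩ := hpF_cont n hF x
    have hss : Ioo 0 δ ⊆ Ioi (0:ℝ) := fun y hy => hy.1
    obtain ⟨r, hr, her⟩ := isPreconnected_Ioo.intermediate_value₂ hr2 hr1 (k1.mono hss)
      ((k2.mono hss).const_mul c) hcase.le h1'
    refine ⟨r, hr, her.ge, ?_⟩
    have := e r
    nlinarith [hb r]

/-! ### Local disjointness and comparison of densities -/

theorem hpF_away (n : ℕ) {A : Set (EucSp n)} {x : EucSp n} (h : x ∉ closure A) :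
    ∃ δ > (0:ℝ), ∀ r, r < δ → Disjoint (ball x r) A := by
  have : (closure A)ᶜ ∈ 𝓝 x := isClosed_closure.isOpen_compl.mem_nhds h
  obtain ⟨δ, hδ, hb⟩ := Metric.mem_nhds_iff.1 this
  refine ⟨δ, hδ, fun r hr => ?_⟩
  rw [Set.disjoint_left]
  intro y hy hyA
  exact hb (ball_subset_ball hr.le hy) (subset_closure hyA)

theorem hpF_away_fin (n : ℕ) {D : ℕ → Set (EucSp n)} {x : EucSp n} (p : ℕ → Prop)
    (h : ∀ k, p k → x ∉ closure (D k)) (N : ℕ) :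
    ∃ δ > (0:ℝ), ∀ r, r < δ → ∀ k < N, p k → Disjoint (ball x r) (D k) := by
  induction N with
  | zero => exact ⟨1, one_pos, fun r _ k hk => absurd hk (by omega)⟩
  | succ N ih =>
    obtain ⟨δ, hδ, h1⟩ := ih
    by_cases hp : p N
    · obtain ⟨δ', hδ', h2⟩ := hpF_away n (h N hp)
      refine ⟨min δ δ', lt_min hδ hδ', fun r hr k hk hpk => ?_⟩
      rcases Nat.lt_succ_iff_lt_or_eq.1 hk with h3 | rfl
      · exact h1 r (hr.trans_le (min_le_left _ _)) k h3 hpk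
      · exact h2 r (hr.trans_le (min_le_right _ _))
    · refine ⟨δ, hδ, fun r hr k hk hpk => ?_⟩
      rcases Nat.lt_succ_iff_lt_or_eq.1 hk with h3 | rfl
      · exact h1 r hr k h3 hpk
      · exact absurd hpk hp

theorem hpF_geom : (∑' k : ℕ, (2 ^ (k + 3) : ℝ≥0∞)⁻¹) ≠ ⊤ := by
  have h : ∑' k : ℕ, (2 ^ (k + 3) : ℝ≥0∞)⁻¹ ≤ ∑' k : ℕ, (2⁻¹ : ℝ≥0∞) ^ k := by
    refine ENNReal.tsum_le_tsum fun k => ?_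
    rw [← ENNReal.inv_pow, ENNReal.inv_le_inv]
    exact pow_le_pow_right₀ (by norm_num) (by omega)
  refine ne_top_of_le_ne_top ?_ h
  rw [ENNReal.tsum_geometric, ENNReal.one_sub_inv_two, inv_inv]
  simp

theorem hpF_rest (n : ℕ) (D : ℕ → Set (EucSp n))
    (hdisj : Pairwise (fun k k' => closure (D k) ∩ closure (D k') = ∅))
    (hdens : ∀ k, 0 < k → ∀ z ∈ ⋃ k' ∈ Finset.range k, closure (D k'), ∀ s > (0:ℝ),
      volume (ball z s ∩ D k) < (2 ^ (k + 3) : ℝ≥0∞)⁻¹ * volume (ball z s))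
    (j : ℕ) (x : EucSp n) (hx : x ∈ closure (D j)) :
    DensityEq n (⋃ (k) (_ : k ≠ j), D k) x 0 := by
  rw [DensityEq, ENNReal.tendsto_nhds_zero]
  intro ε hε
  have htail := ENNReal.tendsto_sum_nat_add (fun k : ℕ => (2 ^ (k + 3) : ℝ≥0∞)⁻¹) hpF_geom
  rw [ENNReal.tendsto_nhds_zero] at htail
  obtain ⟨N, hN, hjN⟩ := ((htail ε hε).and (eventually_gt_atTop j)).exists
  obtain ⟨δ, hδ, hfar⟩ := hpF_away_fin n (D := D) (x := x) (fun k => k ≠ j) (by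
    intro k hk hxk
    have : x ∈ closure (D k) ∩ closure (D j) := ⟨hxk, hx⟩
    rw [hdisj hk] at this
    exact this) N
  filter_upwards [Ioo_mem_nhdsGT hδ] with r hr
  refine le_trans ?_ hN
  apply ENNReal.div_le_of_le_mul
  rw [← ENNReal.tsum_mul_right]
  calc volume ((⋃ (k) (_ : k ≠ j), D k) ∩ ball x r) ≤ volume (⋃ i, (ball x r ∩ D (i + N))) := by
        apply measure_mono
        rintro y ⟨hy1, hy2⟩
        simp only [mem_iUnion] at hy1
        obtain ⟨k, hk, hyk⟩ := hy1
        have hkN : N ≤ k := by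
          by_contra! hlt
          exact (hfar r hr.2 k hlt hk).le_bot ⟨hy2, hyk⟩
        refine mem_iUnion.2 ⟨k - N, hy2, ?_⟩
        rwa [Nat.sub_add_cancel hkN]
    _ ≤ _ := measure_iUnion_le _
    _ ≤ _ := by
        refine ENNReal.tsum_le_tsum fun i => (hdens (i+N) (by omega) x ?_ r hr.1).le
        simp only [mem_iUnion]
        exact ⟨j, Finset.mem_range.2 (by omega), hx⟩

theorem hpF_same (n : ℕ) (D : ℕ → Set (EucSp n)) (hopen : ∀ k, IsOpen (D k))
    (hdisj : Pairwise (fun k k' => closure (D k) ∩ closure (D k') = ∅))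
    (hdens : ∀ k, 0 < k → ∀ z ∈ ⋃ k' ∈ Finset.range k, closure (D k'), ∀ s > (0:ℝ),
      volume (ball z s ∩ D k) < (2 ^ (k + 3) : ℝ≥0∞)⁻¹ * volume (ball z s))
    (j : ℕ) (x : EucSp n) (hx : x ∈ closure (D j)) :
    x ∈ essBdry n (⋃ k, D k) ↔ x ∈ essBdry n (D j) := by
  have hR := hpF_rest n D hdisj hdens j x hx
  set R := ⋃ (k) (_ : k ≠ j), D k with hRdef
  have hU : ∀ r, volume ((⋃ k, D k) ∩ ball x r) / volume (ball x r) =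
      volume (D j ∩ ball x r) / volume (ball x r) + volume (R ∩ ball x r) / volume (ball x r) := by
    intro r
    rw [← ENNReal.add_div, ← measure_union]
    · congr 2
      ext y
      simp only [hRdef, mem_inter_iff, mem_union, mem_iUnion]
      constructor
      · rintro ⟨⟨k, hk⟩, hy⟩
        by_cases hkj : k = j
        · exact Or.inl ⟨hkj ▸ hk, hy⟩
        · exact Or.inr ⟨⟨k, hkj, hk⟩, hy⟩
      · rintro (⟨hk, hy⟩ | ⟨⟨k, _, hk⟩, hy⟩)
        · exact ⟨⟨j, hk⟩, hy⟩
        · exact ⟨⟨k, hk⟩, hy⟩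
    · rw [Set.disjoint_left]
      rintro y ⟨hy1, _⟩ ⟨hy2, _⟩
      simp only [hRdef, mem_iUnion] at hy2
      obtain ⟨k, hk, hyk⟩ := hy2
      have : y ∈ closure (D k) ∩ closure (D j) := ⟨subset_closure hyk, subset_closure hy1⟩
      rw [hdisj hk] at this
      exact this
    · refine MeasurableSet.inter ?_ measurableSet_ball
      exact MeasurableSet.iUnion fun k => MeasurableSet.iUnion fun _ => (hopen k).measurableSet
  have hiff : ∀ t : ℝ≥0∞, DensityEq n (⋃ k, D k) x t ↔ DensityEq n (D j) x t := by
    intro t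
    constructor
    · intro h
      have := ENNReal.Tendsto.sub h hR (Or.inr ENNReal.zero_ne_top)
      rw [tsub_zero] at this
      refine this.congr' ?_
      filter_upwards [self_mem_nhdsWithin] with r hr
      rw [hU]
      refine ENNReal.add_sub_cancel_right ?_
      refine (ENNReal.div_lt_top ?_ (hpF_ball_ne_zero n x hr)).ne
      exact measure_ne_top_of_subset inter_subset_right (hpF_ball_ne_top n x r)
    · intro h
      have := h.add hR
      rw [add_zero] at this
      refine this.congr fun r => (hU r).symm
  simp only [essBdry, mem_compl_iff, mem_union, densPts, mem_setOf_eq, hiff]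

/-! ### The limit set is negligible -/

theorem hpF_exc (n : ℕ) (W : Set (EucSp n)) (hW : IsClosed W) (D : ℕ → Set (EucSp n))
    (hopen : ∀ k, IsOpen (D k)) (hper : ∑' k, perimIn n (D k) Wᶜ < ⊤) :
    μH[n] {x | x ∈ Wᶜ ∧ x ∈ essBdry n (⋃ k, D k) ∧ ∀ k, x ∉ closure (D k)} = 0 := by
  set F := ⋃ k, D k with hF
  have hFm : MeasurableSet F := (isOpen_iUnion hopen).measurableSet
  let S : ℕ → Set (EucSp n) := fun j => {x | x ∈ Wᶜ ∧ (∀ k, x ∉ closure (D k)) ∧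
    ∀ δ > (0:ℝ), ∃ r ∈ Ioo 0 δ, (1/((j:ℝ)+1)) * volume.real (ball x r) ≤ volume.real (F ∩ ball x r) ∧
      (1/((j:ℝ)+1)) * volume.real (ball x r) ≤ volume.real (Fᶜ ∩ ball x r)}
  have hcover : {x | x ∈ Wᶜ ∧ x ∈ essBdry n F ∧ ∀ k, x ∉ closure (D k)} ⊆ ⋃ j, S j := by
    rintro x ⟨h1, h2, h3⟩
    obtain ⟨c, hc, h4⟩ := hpF_mid n hFm h2
    obtain ⟨j, hj⟩ := exists_nat_one_div_lt hc
    refine mem_iUnion.2 ⟨j, h1, h3, fun δ hδ => ?_⟩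
    obtain ⟨r, hr, h5, h6⟩ := h4 δ hδ
    have hb : 0 ≤ volume.real (ball x r) := measureReal_nonneg
    have := mul_le_mul_of_nonneg_right hj.le hb
    exact ⟨r, hr, this.trans h5, this.trans h6⟩
  refine measure_mono_null hcover (measure_iUnion_null fun j => ?_)
  let μ : ℕ → Measure (EucSp n) := fun N =>
    Measure.sum fun k => (μH[n] : Measure (EucSp n)).restrict (Wᶜ ∩ essBdry n (D (k + N)))
  have hμ : ∀ N, μ N univ = ∑' k, perimIn n (D (k + N)) Wᶜ := by
    intro N
    simp [μ, Measure.sum_apply _ MeasurableSet.univ, perimIn, redBdry]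
  have hμ0 : Tendsto (fun N => μ N univ) atTop (𝓝 0) := by
    simp only [hμ]
    exact ENNReal.tendsto_sum_nat_add (fun k => perimIn n (D k) Wᶜ) hper.ne
  set κ := volume (ball (0 : EucSp n) 1) with hκ
  have hκ0 : κ ≠ 0 := hpF_ball_ne_zero n 0 one_pos
  have hκt : κ ≠ ⊤ := hpF_ball_ne_top n 0 1
  set c := ENNReal.ofReal (1/((j:ℝ)+1)) with hc
  have hc0 : c ≠ 0 := by
    rw [hc, Ne, ENNReal.ofReal_eq_zero, not_le]; positivity
  have hct : c ≠ ⊤ := ENNReal.ofReal_ne_top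
  set K := c ^ 2 * κ ^ 2 with hK
  set L := κ * hpC n * ENNReal.ofReal (2 ^ (n+2)) with hL
  have h2pos : ENNReal.ofReal (2 ^ (n+2)) ≠ 0 := by
    rw [Ne, ENNReal.ofReal_eq_zero, not_le]; positivity
  have hL0 : L ≠ 0 := mul_ne_zero (mul_ne_zero hκ0 (hpC_ne_zero n)) h2pos
  have hLt : L ≠ ⊤ := ENNReal.mul_ne_top (ENNReal.mul_ne_top hκt (hpC_ne_top n)) ENNReal.ofReal_ne_top
  have hK0 : K ≠ 0 := mul_ne_zero (pow_ne_zero _ hc0) (pow_ne_zero _ hκ0)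
  have hKt : K ≠ ⊤ := ENNReal.mul_ne_top (ENNReal.pow_ne_top hct) (ENNReal.pow_ne_top hκt)
  have ha0 : K / L ≠ 0 := ENNReal.div_ne_zero.2 ⟨hK0, hLt⟩
  have hat : K / L ≠ ⊤ := (ENNReal.div_lt_top hKt hL0).ne
  have hbound : ∀ N, μH[n] (S j) ≤ ENNReal.ofReal (10 ^ n) * (K / L)⁻¹ * μ N univ := by
    intro N
    refine hpF_vitali n (μ N) (S j) (K / L) ha0 hat ?_
    rintro x ⟨hxW, hxD, hx⟩ δ hδ
    obtain ⟨δ1, hδ1, hfar⟩ := hpF_away_fin n (D := D) (x := x) (fun _ => True) (fun k _ => hxD k) N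
    obtain ⟨δ2, hδ2, hball⟩ := Metric.mem_nhds_iff.1 (hW.isOpen_compl.mem_nhds hxW)
    obtain ⟨r, hr, h1, h2⟩ := hx (min δ (min δ1 δ2)) (by positivity)
    have hrδ : r < δ := hr.2.trans_le (min_le_left _ _)
    have hrδ1 : r < δ1 := hr.2.trans_le ((min_le_right _ _).trans (min_le_left _ _))
    have hrδ2 : r < δ2 := hr.2.trans_le ((min_le_right _ _).trans (min_le_right _ _))
    refine ⟨r, ⟨hr.1, hrδ⟩, ?_⟩
    have hr0 : 0 < r := hr.1
    have hGF : ∀ y ∈ ball x r, (y ∈ F ↔ y ∈ ⋃ k, D (k + N)) := by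
      intro y hy
      simp only [hF, mem_iUnion]
      constructor
      · rintro ⟨k, hk⟩
        have hkN : N ≤ k := by
          by_contra! hlt
          exact (hfar r hrδ1 k hlt trivial).le_bot ⟨hy, hk⟩
        exact ⟨k - N, by rwa [Nat.sub_add_cancel hkN]⟩
      · rintro ⟨k, hk⟩
        exact ⟨_, hk⟩
    have e1 : F ∩ ball x r = (⋃ k, D (k + N)) ∩ ball x r := by
      ext y
      constructor
      · rintro ⟨h, h'⟩; exact ⟨(hGF y h').1 h, h'⟩
      · rintro ⟨h, h'⟩; exact ⟨(hGF y h').2 h, h'⟩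
    have e2 : Fᶜ ∩ ball x r = (⋃ k, D (k + N))ᶜ ∩ ball x r := by
      ext y
      constructor
      · rintro ⟨h, h'⟩; exact ⟨fun h'' => h ((hGF y h').2 h''), h'⟩
      · rintro ⟨h, h'⟩; exact ⟨fun h'' => h ((hGF y h').1 h''), h'⟩
    have conv : ∀ H : Set (EucSp n), (1/((j:ℝ)+1)) * volume.real (ball x r) ≤ volume.real (H ∩ ball x r) →
        c * volume (ball x r) ≤ volume (H ∩ ball x r) := by
      intro H hH
      have ht := hpF_ball_ne_top n x r
      have ht' : volume (H ∩ ball x r) ≠ ⊤ := measure_ne_top_of_subset inter_subset_right ht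
      rw [← ENNReal.ofReal_toReal ht, ← ENNReal.ofReal_toReal ht', hc, ← ENNReal.ofReal_mul (by positivity)]
      exact ENNReal.ofReal_le_ofReal hH
    have g1 := conv _ h1
    have g2 := conv _ h2
    rw [e1] at g1
    rw [e2] at g2
    have hiso := (mul_le_mul' g1 g2).trans
      (hpF_isop n (fun k => D (k + N)) (fun k => (hopen _).measurableSet) x hr0)
    have hsum : ∑' k, μH[n] (ball x r ∩ essBdry n (D (k + N))) ≤ μ N (closedBall x r) := by
      simp only [μ, Measure.sum_apply _ measurableSet_closedBall]
      refine ENNReal.tsum_le_tsum fun k => ?_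
      rw [Measure.restrict_apply measurableSet_closedBall]
      apply measure_mono
      rintro y ⟨hy, hy'⟩
      exact ⟨ball_subset_closedBall hy, hball (ball_subset_ball hrδ2.le hy), hy'⟩
    have hfinal : K * ENNReal.ofReal (r ^ n) ≤ μ N (closedBall x r) * L := by
      have hX0 : ENNReal.ofReal (r ^ (n+2)) ≠ 0 := by
        rw [Ne, ENNReal.ofReal_eq_zero, not_le]; positivity
      rw [← ENNReal.mul_le_mul_iff_right hX0 ENNReal.ofReal_ne_top]
      calc ENNReal.ofReal (r ^ (n+2)) * (K * ENNReal.ofReal (r ^ n))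
          = c * volume (ball x r) * (c * volume (ball x r)) := by
            rw [hpF_ball n x hr0.le, ← hκ, hK]
            have : ENNReal.ofReal (r ^ (n+2)) * ENNReal.ofReal (r ^ n) =
              ENNReal.ofReal (r ^ (n+1)) * ENNReal.ofReal (r ^ (n+1)) := by
              rw [← ENNReal.ofReal_mul (by positivity), ← ENNReal.ofReal_mul (by positivity)]
              congr 1; ring
            calc _ = c ^ 2 * κ ^ 2 * (ENNReal.ofReal (r ^ (n+2)) * ENNReal.ofReal (r ^ n)) := by ring
              _ = _ := by rw [this]; ring
        _ ≤ _ := hiso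
        _ ≤ volume (ball (0 : EucSp n) (2 * r)) *
            (hpC n * ENNReal.ofReal (2 * r) * μ N (closedBall x r)) := by gcongr
        _ = _ := by
            rw [hpF_ball n 0 (by positivity), ← hκ, hL]
            have : ENNReal.ofReal ((2 * r) ^ (n+1)) * ENNReal.ofReal (2 * r) =
              ENNReal.ofReal (r ^ (n+2)) * ENNReal.ofReal (2 ^ (n+2)) := by
              rw [← ENNReal.ofReal_mul (by positivity), ← ENNReal.ofReal_mul (by positivity)]
              congr 1; ring
            calc _ = (ENNReal.ofReal ((2 * r) ^ (n+1)) * ENNReal.ofReal (2 * r)) * (κ * hpC n * μ N (closedBall x r)) := by ring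
              _ = _ := by rw [this]; ring
    calc K / L * ENNReal.ofReal (r ^ n) = K * ENNReal.ofReal (r ^ n) / L := by
          rw [div_eq_mul_inv, div_eq_mul_inv]; ring
      _ ≤ _ := ENNReal.div_le_of_le_mul hfinal
  have hlim : Tendsto (fun N => ENNReal.ofReal (10 ^ n) * (K / L)⁻¹ * μ N univ) atTop (𝓝 0) := by
    have := ENNReal.Tendsto.const_mul hμ0 (a := ENNReal.ofReal (10 ^ n) * (K / L)⁻¹)
      (Or.inr (ENNReal.mul_ne_top ENNReal.ofReal_ne_top (ENNReal.inv_ne_top.2 ha0)))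
    simpa using this
  exact le_antisymm (ge_of_tendsto' hlim hbound) (zero_le)

theorem hpF_ess_closure (n : ℕ) (E : Set (EucSp n)) : essBdry n E ⊆ closure E := by
  intro x hx
  by_contra h
  apply hx
  left
  obtain ⟨δ, hδ, h1⟩ := hpF_away n h
  refine tendsto_const_nhds.congr' ?_
  filter_upwards [Ioo_mem_nhdsGT hδ] with r hr
  have : E ∩ ball x r = ∅ := by rw [inter_comm]; exact (h1 r hr.2).inter_eq
  simp [this]


/-- **Step five of the proof of Theorem 1.1.** If `{𝒟_k}_{k≥0}` are open sets of finite
perimeter in `Ω` with pairwise disjoint closures satisfying the separation, volume, density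
and perimeter conditions (i)–(iv), then `F = ⋃_k 𝒟_k` is a set of finite perimeter in `Ω`
with `|F| ≤ δ/2`, `P(F;Ω) ≤ ∑_k P(𝒟_k;Ω)`, and `Ω ∩ ∂*F` is `H^n`-equivalent to
`⋃_k ∂*𝒟_k`. -/
theorem union_of_replacement_sets_has_finite_perimeter
    (n : ℕ) (W : Set (EucSp n)) (hW : IsClosed W) (δ : ℝ) (hδ : 0 < δ)
    (D : ℕ → Set (EucSp n)) (hopen : ∀ k, IsOpen (D k)) (hsub : ∀ k, D k ⊆ Wᶜ)
    (hdisj : Pairwise (fun k k' => closure (D k) ∩ closure (D k') = ∅))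
    -- (i)
    (hdist : ∀ k, 0 < k → ∃ ε > (0:ℝ), ∀ p ∈ D k,
      ∀ q ∈ ⋃ k' ∈ Finset.range k, closure (D k'), ε ≤ dist p q)
    -- (ii)
    (hvol : ∀ k, volume (D k) ≤ ENNReal.ofReal (δ / 2 ^ (k + 2)))
    -- (iii)
    (hdens : ∀ k, 0 < k → ∀ z ∈ ⋃ k' ∈ Finset.range k, closure (D k'), ∀ s > (0:ℝ),
      volume (ball z s ∩ D k) < (2 ^ (k + 3) : ℝ≥0∞)⁻¹ * volume (ball z s))
    -- (iv)
    (hper : ∑' k, perimIn n (D k) Wᶜ < ⊤) :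
    HasFinitePerimeterIn n (⋃ k, D k) Wᶜ ∧
    volume (⋃ k, D k) ≤ ENNReal.ofReal (δ / 2) ∧
    perimIn n (⋃ k, D k) Wᶜ ≤ ∑' k, perimIn n (D k) Wᶜ ∧
    μH[n] ((Wᶜ ∩ redBdry n (⋃ k, D k)) ∆ (⋃ k, Wᶜ ∩ redBdry n (D k))) = 0 := by
  have hsubs : ∀ k, Wᶜ ∩ redBdry n (D k) ⊆ Wᶜ ∩ redBdry n (⋃ k, D k) := by
    rintro k x ⟨h1, h2⟩
    exact ⟨h1, (hpF_same n D hopen hdisj hdens k x (hpF_ess_closure n _ h2)).2 h2⟩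
  have hexc := hpF_exc n W hW D hopen hper
  set S := {x | x ∈ Wᶜ ∧ x ∈ essBdry n (⋃ k, D k) ∧ ∀ k, x ∉ closure (D k)} with hS
  have hsub2 : Wᶜ ∩ redBdry n (⋃ k, D k) ⊆ (⋃ k, Wᶜ ∩ redBdry n (D k)) ∪ S := by
    rintro x ⟨h1, h2⟩
    by_cases h : ∃ k, x ∈ closure (D k)
    · obtain ⟨k, hk⟩ := h
      exact Or.inl (mem_iUnion.2 ⟨k, h1, (hpF_same n D hopen hdisj hdens k x hk).1 h2⟩)
    · exact Or.inr ⟨h1, h2, not_exists.1 h⟩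
  have hle : perimIn n (⋃ k, D k) Wᶜ ≤ ∑' k, perimIn n (D k) Wᶜ := by
    calc perimIn n (⋃ k, D k) Wᶜ ≤ _ := measure_mono hsub2
      _ ≤ _ := measure_union_le _ _
      _ = μH[n] (⋃ k, Wᶜ ∩ redBdry n (D k)) := by rw [hexc, add_zero]
      _ ≤ _ := measure_iUnion_le _
  refine ⟨hle.trans_lt hper, ?_, hle, ?_⟩
  · have hs : HasSum (fun k : ℕ => δ / 2 ^ (k + 2)) (δ / 2) := by
      have := hasSum_geometric_two.mul_left (δ / 4)
      have e : (fun k : ℕ => δ / 2 ^ (k + 2)) = fun k : ℕ => δ / 4 * (1 / 2) ^ k := by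
        ext k
        have h2 : (2 : ℝ) ^ k ≠ 0 := by positivity
        rw [pow_add, one_div, inv_pow]
        field_simp
        norm_num
      rw [e, show δ / 2 = δ / 4 * 2 by ring]
      exact this
    calc volume (⋃ k, D k) ≤ ∑' k, volume (D k) := measure_iUnion_le _
      _ ≤ ∑' k : ℕ, ENNReal.ofReal (δ / 2 ^ (k + 2)) := ENNReal.tsum_le_tsum hvol
      _ = ENNReal.ofReal (δ / 2) := by
          rw [← ENNReal.ofReal_tsum_of_nonneg (fun k => by positivity) hs.summable, hs.tsum_eq]
  · refine measure_mono_null ?_ hexc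
    rintro x (⟨h1, h2⟩ | ⟨h1, h2⟩)
    · exact (hsub2 h1).resolve_left h2
    · obtain ⟨k, hk⟩ := mem_iUnion.1 h1
      exact absurd (hsubs k hk) h2
end

section
/- Let {D_k}_{k∈ℕ} be pairwise disjoint Lebesgue measurable subsets of ℝ^{n+1} and set F = ⋃_k D_k. Suppose x ∈ ℝ^{n+1} and k ∈ ℕ satisfy: (i) D_k has Lebesgue density 1/2 at x, i.e. lim_{r→0} |D_k ∩ B_r(x)|/|B_r(x)| = 1/2; (ii) there exists r_x > 0 with B_{r_x}(x) ∩ D_{k'} = ∅ for all k' < k; (iii) for every k' > k, |B_s(z) ∩ D_{k'}| ≤ 2^{−k'−3} |B_s(z)| for all s > 0 and all z ∈ cl D_k. Then 1/2 ≤ limsup_{r→0} |F ∩ B_r(x)|/|B_r(x)| ≤ 3/4; in particular the Lebesgue density of F at x is neither 0 nor 1, so x belongs to the essential boundary ∂^e F. -/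
open MeasureTheory Set Metric Filter Function
open scoped ENNReal Topology Manifold symmDiff NNReal RealInnerProductSpace

/-- **The density estimate (4.33) in Step five of the proof of Theorem 1.1.** If `{D_k}`
are pairwise disjoint measurable sets, `F = ⋃_k D_k`, `D_k` has density `1/2` at `x`,
`B_{r_x}(x)` avoids `D_{k'}` for `k' < k`, and `|B_s(z) ∩ D_{k'}| ≤ 2^{-k'-3}|B_s(z)|` for
`k' > k`, `z ∈ cl D_k`, `s > 0`, then
`1/2 ≤ limsup_{r→0} |F ∩ B_r(x)|/|B_r(x)| ≤ 3/4`; in particular `x ∈ ∂ᵉF`. -/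
theorem density_estimate_for_union
    (n : ℕ) (D : ℕ → Set (EucSp n)) (hmeas : ∀ k, MeasurableSet (D k))
    (hdisj : Pairwise (Function.onFun Disjoint D)) (x : EucSp n) (k : ℕ)
    (hhalf : Tendsto (fun r : ℝ => volume (D k ∩ ball x r) / volume (ball x r))
      (𝓝[>] 0) (𝓝 (1/2)))
    (hrx : ∃ rx > (0:ℝ), ∀ k' < k, ball x rx ∩ D k' = ∅)
    (hsmall : ∀ k', k < k' → ∀ z ∈ closure (D k), ∀ s > (0:ℝ),
      volume (ball z s ∩ D k') ≤ (2 ^ (k' + 3) : ℝ≥0∞)⁻¹ * volume (ball z s)) :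
    (1/2 : ℝ≥0∞) ≤
      limsup (fun r : ℝ => volume ((⋃ j, D j) ∩ ball x r) / volume (ball x r)) (𝓝[>] 0) ∧
    limsup (fun r : ℝ => volume ((⋃ j, D j) ∩ ball x r) / volume (ball x r)) (𝓝[>] 0)
      ≤ 3/4 ∧
    x ∈ essBdry n (⋃ j, D j) := by
  classical
  obtain ⟨rx, hrx0, hrx⟩ := hrx
  have hpos : ∀ᶠ r : ℝ in 𝓝[>] 0, 0 < r := eventually_mem_nhdsWithin
  have hxc : x ∈ closure (D k) := by
    by_contra hx
    obtain ⟨ε, hε, hb⟩ := Metric.isOpen_iff.1 isClosed_closure.isOpen_compl x hx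
    have hlt : ∀ᶠ r : ℝ in 𝓝[>] 0, r < ε :=
      mem_nhdsWithin_of_mem_nhds (Iio_mem_nhds hε)
    have h0 : Tendsto (fun r : ℝ => volume (D k ∩ ball x r) / volume (ball x r))
        (𝓝[>] 0) (𝓝 0) := by
      refine tendsto_const_nhds.congr' ?_
      filter_upwards [hlt] with r hr
      have : D k ∩ ball x r = ∅ := by
        ext y
        simp only [Set.mem_inter_iff, Set.mem_empty_iff_false, iff_false, not_and]
        intro hy hyb
        exact hb (ball_subset_ball hr.le hyb) (subset_closure hy)
      simp [this]
    have := tendsto_nhds_unique hhalf h0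
    simp at this
  have hsum : ∑' j : ℕ, (2 ^ (j + 3) : ℝ≥0∞)⁻¹ = 1/4 := by
    have h1 : ∀ j : ℕ, (2 ^ (j + 3) : ℝ≥0∞)⁻¹ = 2⁻¹ ^ j * 8⁻¹ := by
      intro j
      rw [pow_add, ENNReal.mul_inv (by simp) (by simp), ENNReal.inv_pow]
      norm_num
    simp_rw [h1]
    rw [ENNReal.tsum_mul_right, ENNReal.tsum_geometric, ENNReal.one_sub_inv_two, inv_inv,
      show (8 : ℝ≥0∞) = 2 * 4 by norm_num, ENNReal.mul_inv (by simp) (by simp), ← mul_assoc,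
      ENNReal.mul_inv_cancel (by simp) (by simp)]
    simp
  have hlow : ∀ᶠ r : ℝ in 𝓝[>] 0, volume (D k ∩ ball x r) / volume (ball x r) ≤
      volume ((⋃ j, D j) ∩ ball x r) / volume (ball x r) := by
    refine Eventually.of_forall fun r => ?_
    gcongr
    exact subset_iUnion D k
  have hup : ∀ᶠ r : ℝ in 𝓝[>] 0, volume ((⋃ j, D j) ∩ ball x r) / volume (ball x r) ≤
      volume (D k ∩ ball x r) / volume (ball x r) + 1/4 := by
    have hlt : ∀ᶠ r : ℝ in 𝓝[>] 0, r < rx :=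
      mem_nhdsWithin_of_mem_nhds (Iio_mem_nhds hrx0)
    filter_upwards [hpos, hlt] with r hr hrr
    have hv0 : volume (ball x r) ≠ 0 := (measure_ball_pos volume x hr).ne'
    have hvt : volume (ball x r) ≠ ⊤ := measure_ball_lt_top.ne
    have key : volume ((⋃ j, D j) ∩ ball x r) ≤
        volume (D k ∩ ball x r) + 1/4 * volume (ball x r) := by
      have hsub : (⋃ j, D j) ∩ ball x r ⊆
          (D k ∩ ball x r) ∪ ⋃ j, (if k < j then ball x r ∩ D j else ∅) := by
        rintro y ⟨hy, hyb⟩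
        obtain ⟨j, hj⟩ := mem_iUnion.1 hy
        rcases lt_trichotomy j k with h | h | h
        · have : y ∈ ball x rx ∩ D j := ⟨ball_subset_ball hrr.le hyb, hj⟩
          rw [hrx j h] at this
          exact this.elim
        · subst h
          exact Or.inl ⟨hj, hyb⟩
        · refine Or.inr (mem_iUnion.2 ⟨j, ?_⟩)
          rw [if_pos h]
          exact ⟨hyb, hj⟩
      refine (measure_mono hsub).trans ((measure_union_le _ _).trans ?_)
      gcongr
      refine (measure_iUnion_le _).trans ?_
      rw [← hsum, ← ENNReal.tsum_mul_right]
      refine ENNReal.tsum_le_tsum fun j => ?_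
      split_ifs with h
      · exact hsmall j h x hxc r hr
      · simp
    calc _ ≤ (volume (D k ∩ ball x r) + 1/4 * volume (ball x r)) / volume (ball x r) := by
          gcongr
      _ = _ := by
          rw [ENNReal.add_div, ENNReal.mul_div_cancel_right hv0 hvt]
  have hA : (1/2 : ℝ≥0∞) ≤
      limsup (fun r : ℝ => volume ((⋃ j, D j) ∩ ball x r) / volume (ball x r)) (𝓝[>] 0) := by
    rw [← hhalf.limsup_eq]
    exact limsup_le_limsup hlow
  have hB : limsup (fun r : ℝ => volume ((⋃ j, D j) ∩ ball x r) / volume (ball x r)) (𝓝[>] 0)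
      ≤ 3/4 := by
    have h34 : (1/2 + 1/4 : ℝ≥0∞) = 3/4 := by
      rw [← ENNReal.toReal_eq_toReal_iff' (by finiteness) (by finiteness),
        ENNReal.toReal_add (by finiteness) (by finiteness)]
      norm_num
    rw [← h34, ← (hhalf.add_const (1/4)).limsup_eq]
    exact limsup_le_limsup hup
  refine ⟨hA, hB, ?_⟩
  rintro (h | h)
  · have h' : Tendsto (fun r : ℝ => volume ((⋃ j, D j) ∩ ball x r) / volume (ball x r))
      (𝓝[>] 0) (𝓝 0) := h
    rw [h'.limsup_eq] at hA
    simp at hA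
  · have h' : Tendsto (fun r : ℝ => volume ((⋃ j, D j) ∩ ball x r) / volume (ball x r))
      (𝓝[>] 0) (𝓝 1) := h
    rw [h'.limsup_eq, ENNReal.le_div_iff_mul_le (by simp) (by simp)] at hB
    norm_num at hB
end
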